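/- arXiv:1511.07251 — 3 statements merged into one kernel-verified Lean document; each statement's English description precedes it below -/
import Mathlib

section
/- Let x ∈ Ω and let Φ be a simplex set for x (i.e., Φ ⊆ Δ_x). Then Ax ⊆ U{a(t)x : t ∈ (n/2)S_Φ}; that is, for every b ∈ A there exist u ∈ U and t ∈ (n/2)S_Φ such that b x = u a(t) x. -/
open scoped Pointwise

noncomputable section

abbrev SLR (d : ℕ) := Matrix.SpecialLinearGroup (Fin d) ℝ

instance (d : ℕ) : TopologicalSpace (SLR d) := instTopologicalSpaceSubtype

def Gamma (d : ℕ) : Subgroup (SLR d) :=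
  (Matrix.SpecialLinearGroup.map (n := Fin d) (Int.castRingHom ℝ)).range

abbrev XSpace (d : ℕ) := SLR d ⧸ Gamma d

def latticeOf (d : ℕ) (x : XSpace d) : Set (Fin d → ℝ) :=
  {w | ∃ g : SLR d, (QuotientGroup.mk g : XSpace d) = x ∧
      ∃ v : Fin d → ℤ, w = (g : Matrix (Fin d) (Fin d) ℝ).mulVec fun i => (v i : ℝ)}

def shortest (d : ℕ) (x : XSpace d) : ℝ :=
  sInf {r | ∃ w ∈ latticeOf d x, w ≠ 0 ∧ r = ‖w‖}

def aSL (d : ℕ) (t : Fin d → ℝ) (ht : ∑ i, t i = 0) : SLR d :=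
  ⟨Matrix.diagonal fun i => Real.exp (t i), by
    rw [Matrix.det_diagonal, ← Real.exp_sum, ht, Real.exp_zero]⟩

def Aorbit (d : ℕ) (x : XSpace d) : Set (XSpace d) :=
  {y | ∃ (t : Fin d → ℝ) (ht : ∑ i, t i = 0), y = aSL d t ht • x}

def stdLat (d : ℕ) : XSpace d := QuotientGroup.mk 1

/-- The hyperplane `ℝ^d_0` of zero coordinate sum, as a set. -/
def V0 (d : ℕ) : Set (Fin d → ℝ) := {t | ∑ i, t i = 0}

/-- The hyperplane `ℝ^d_0`, as a submodule. -/
def V0sub (d : ℕ) : Submodule ℝ (Fin d → ℝ) :=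
  LinearMap.ker (∑ i : Fin d, LinearMap.proj i)

/-- A simplex set: `d` vectors in `ℝ^d_0` summing to zero and spanning `ℝ^d_0`. -/
structure SimplexSet (d : ℕ) where
  elems : Finset (Fin d → ℝ)
  card_eq : elems.card = d
  sum_eq_zero : elems.sum id = 0
  span_eq : Submodule.span ℝ (elems : Set (Fin d → ℝ)) = V0sub d

/-- The lattice `Δ_Φ` associated to a simplex set. -/
def latticeOfSS {d : ℕ} (Φ : SimplexSet d) : AddSubgroup (Fin d → ℝ) :=
  AddSubgroup.closure (Φ.elems : Set (Fin d → ℝ))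

/-- `⌈t⌉ = max_i t_i`. -/
def ceilMax {d : ℕ} (t : Fin d → ℝ) : ℝ := ⨆ i, t i

/-- `ξ_Φ = max_{t ∈ Φ} ⌈t⌉`. -/
def xi {d : ℕ} (Φ : SimplexSet d) : ℝ :=
  sSup (ceilMax '' (Φ.elems : Set (Fin d → ℝ)))

/-- Square root of the absolute Gram determinant of a `(d-1)`-tuple of vectors. -/
def gram (d : ℕ) (v : Fin (d - 1) → (Fin d → ℝ)) : ℝ :=
  Real.sqrt |(Matrix.of fun i j : Fin (d - 1) => ∑ k, v i k * v j k).det|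

/-- The (euclidean) covolume of the lattice generated by a set `S ⊆ ℝ^d_0` of rank `d-1`:
the common value of the Gram determinant over all `(d-1)`-tuples generating the same
subgroup as `S`. -/
def covolSet (d : ℕ) (S : Set (Fin d → ℝ)) : ℝ :=
  sInf {r | ∃ v : Fin (d - 1) → (Fin d → ℝ),
      AddSubgroup.closure (Set.range v) = AddSubgroup.closure S ∧ r = gram d v}

/-- The covolume `|Δ_Φ|`. -/
def covolSS {d : ℕ} (Φ : SimplexSet d) : ℝ := covolSet d (Φ.elems : Set (Fin d → ℝ))

/-- The set `φ(stab_{UA}(x))` of logarithmic stabilizer times. -/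
def stabSet (d : ℕ) (x : XSpace d) : Set (Fin d → ℝ) :=
  {t | (∑ i, t i = 0) ∧ ∃ ε : Fin d → ℝ, (∀ i, ε i = 1 ∨ ε i = -1) ∧
      (fun v => (Matrix.diagonal fun i => ε i * Real.exp (t i)).mulVec v) '' latticeOf d x
        = latticeOf d x}

/-- The lattice `Δ_x = φ(stab_{UA}(x))`. -/
def DeltaX (d : ℕ) (x : XSpace d) : AddSubgroup (Fin d → ℝ) :=
  AddSubgroup.closure (stabSet d x)

/-- The covolume `|Δ_x|`. -/
def covolX (d : ℕ) (x : XSpace d) : ℝ := covolSet d (stabSet d x)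

/-- `Φ` is an `M`-tight simplex set for `x`. -/
def IsTight (d : ℕ) (M : ℝ) (x : XSpace d) (Φ : SimplexSet d) : Prop :=
  (Φ.elems : Set (Fin d → ℝ)) ⊆ (DeltaX d x : Set (Fin d → ℝ)) ∧
  shortest d x ≤ M * Real.exp (-((d - 1 : ℝ) / 2) * xi Φ)

/-- `Ω_M`: points of `Ω` admitting an `M`-tight simplex set. -/
def OmegaM (d : ℕ) (M : ℝ) : Set (XSpace d) :=
  {x | IsCompact (Aorbit d x) ∧ ∃ Φ : SimplexSet d, IsTight d M x Φ}

/-- The standard simplex set vectors `b_j` (with `-(d-1)` in coordinate `j`, `1` elsewhere). -/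
def bstar (d : ℕ) (j : Fin d) : Fin d → ℝ := fun i => if i = j then -(d - 1 : ℝ) else 1

/-- The points `w_τ^{Φ_*} = τ(d⁻¹ ∑_ℓ (ℓ-1) b_ℓ)`. -/
def wStar (d : ℕ) (τ : Equiv.Perm (Fin d)) : Fin d → ℝ :=
  fun i => (d : ℝ)⁻¹ * ∑ ℓ : Fin d, (ℓ : ℝ) * bstar d ℓ (τ.symm i)

/-- `h` is a distortion map for `Φ`: a linear map with `h Φ_* = |Δ_Φ|^{-1/(d-1)} Φ`. -/
def IsDistortion {d : ℕ} (Φ : SimplexSet d) (h : (Fin d → ℝ) →ₗ[ℝ] (Fin d → ℝ)) : Prop :=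
  h '' Set.range (bstar d) =
    (fun v => (covolSS Φ) ^ (-(1 : ℝ) / (d - 1 : ℝ)) • v) '' (Φ.elems : Set (Fin d → ℝ))

/-- `w_τ^Φ = |Δ_Φ|^{1/(d-1)} h_Φ (w_τ^{Φ_*})`. -/
def wPhi {d : ℕ} (Φ : SimplexSet d) (h : (Fin d → ℝ) →ₗ[ℝ] (Fin d → ℝ))
    (τ : Equiv.Perm (Fin d)) : Fin d → ℝ :=
  (covolSS Φ) ^ ((1 : ℝ) / (d - 1 : ℝ)) • h (wStar d τ)

/-- `S'` is a set of representatives for the cosets `𝒮 / ⟨θ⟩`, `θ` the cyclic rotation. -/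
def IsRepSet (d : ℕ) (S' : Set (Equiv.Perm (Fin d))) : Prop :=
  ∀ τ : Equiv.Perm (Fin d), ∃! σ, σ ∈ S' ∧ τ⁻¹ * σ ∈ Subgroup.zpowers (finRotate d)

/-- The closed ball of radius `r` in `ℝ^d_0`. -/
def ballV0 (d : ℕ) (r : ℝ) : Set (Fin d → ℝ) := {t | (∑ i, t i = 0) ∧ ‖t‖ ≤ r}

/-- Operator norm of a matrix with respect to the supremum norm. -/
def opNorm (d : ℕ) (g : Matrix (Fin d) (Fin d) ℝ) : ℝ :=
  sSup {r | ∃ v : Fin d → ℝ, ‖v‖ ≤ 1 ∧ r = ‖g.mulVec v‖}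

/-- Operator norm of a linear map restricted to the hyperplane `ℝ^d_0`. -/
def normOnV0 (d : ℕ) (h : (Fin d → ℝ) →ₗ[ℝ] (Fin d → ℝ)) : ℝ :=
  sSup {r | ∃ v : Fin d → ℝ, (∑ i, v i = 0) ∧ ‖v‖ ≤ 1 ∧ r = ‖h v‖}

/-- `Ω_M(ε, C)`. -/
def OmegaMEC (d : ℕ) (M ε C : ℝ) : Set (XSpace d) :=
  {x | IsCompact (Aorbit d x) ∧ ∃ Φ : SimplexSet d, IsTight d M x Φ ∧
    ∃ h, IsDistortion Φ h ∧
      ∀ τ : Equiv.Perm (Fin d), ∃ (hw : ∑ i, wPhi Φ h τ i = 0)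
        (g : SLR d) (s : Fin d → ℝ) (hs : ∑ i, s i = 0),
        opNorm d ((g : Matrix (Fin d) (Fin d) ℝ) - 1) ≤ C * Real.exp (-(covolX d x) ^ ε) ∧
        aSL d (wPhi Φ h τ) hw • x = (g * aSL d s hs) • stdLat d}

/-- Homothety–`GL(ℤ)` equivalence of `(d-1)`-tuples: same lattice shape. -/
def shapeRel (d : ℕ) (v w : Fin (d - 1) → (Fin d → ℝ)) : Prop :=
  ∃ c : ℝ, 0 < c ∧ ∃ g : Matrix (Fin (d - 1)) (Fin (d - 1)) ℤ, IsUnit g.det ∧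
    ∀ i, w i = c • ∑ j, ((g i j : ℝ) • v j)

/-- The space of shapes of lattices in `ℝ^d_0` (with the quotient topology). -/
def ShapeSpace (d : ℕ) := Quot (shapeRel d)

instance (d : ℕ) : TopologicalSpace (ShapeSpace d) :=
  instTopologicalSpaceQuot

/-- The shape of the lattice generated by a tuple. -/
def shapeOf (d : ℕ) (v : Fin (d - 1) → (Fin d → ℝ)) : ShapeSpace d := Quot.mk _ v

/-- An enumeration of the elements of a simplex set. -/
def ssEnum {d : ℕ} (Φ : SimplexSet d) : Fin d → (Fin d → ℝ) :=
  fun i => ((Φ.elems.equivFin.symm (finCongr Φ.card_eq.symm i)) : Fin d → ℝ)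

/-- The shape of `Δ_Φ` (generated by the first `d-1` elements of `Φ`). -/
def shapeOfSS {d : ℕ} (Φ : SimplexSet d) : ShapeSpace d :=
  shapeOf d fun i : Fin (d - 1) => ssEnum Φ (Fin.castLE (Nat.sub_le d 1) i)

/-- `Ω_{M,K}`. -/
def OmegaMK (d : ℕ) (M : ℝ) (K : Set (ShapeSpace d)) : Set (XSpace d) :=
  {x | IsCompact (Aorbit d x) ∧ ∃ Φ : SimplexSet d, IsTight d M x Φ ∧ shapeOfSS Φ ∈ K}

lemma exists_sum_fract_sub_le {α : Type*} (s : Finset α) (hs : s.Nonempty) (c : α → ℝ) :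
    ∃ j ∈ s, ∑ i ∈ s, Int.fract (c i - c j) ≤ ((s.card : ℝ) - 1) / 2 := by
  classical
  refine Finset.exists_le_of_sum_le hs ?_
  have hpair : ∀ i j : α, Int.fract (c i - c j) + Int.fract (c j - c i)
      ≤ 1 - if j = i then 1 else 0 := by
    intro i j
    by_cases h : j = i
    · simp [h]
    · rw [if_neg h, ← neg_sub (c i) (c j)]
      by_cases h0 : Int.fract (c i - c j) = 0
      · rw [h0]
        linarith [(Int.fract_lt_one (-(c i - c j))).le]
      · rw [Int.fract_neg h0]
        linarith
  have hsum : ∑ j ∈ s, ∑ i ∈ s, (Int.fract (c i - c j) + Int.fract (c j - c i))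
      ≤ ∑ j ∈ s, ((s.card : ℝ) - 1) := by
    refine Finset.sum_le_sum fun j hj => ?_
    refine (Finset.sum_le_sum fun i _ => hpair i j).trans_eq ?_
    rw [Finset.sum_sub_distrib, Finset.sum_ite_eq, if_pos hj]
    simp
  have hswap : ∑ j ∈ s, ∑ i ∈ s, Int.fract (c j - c i)
      = ∑ j ∈ s, ∑ i ∈ s, Int.fract (c i - c j) := Finset.sum_comm
  simp only [Finset.sum_add_distrib] at hsum
  rw [hswap] at hsum
  rw [← Finset.sum_div]
  linarith

/-- The translates of `((d - 1) / 2) • conv Φ` by the lattice `Δ_Φ` cover `ℝ^d_0`. -/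
lemma SimplexSet.exists_sub_mem_smul_convexHull {d : ℕ} (hd : 2 ≤ d) (Φ : SimplexSet d)
    {t : Fin d → ℝ} (ht : ∑ i, t i = 0) :
    ∃ s ∈ ((d - 1 : ℝ) / 2) • convexHull ℝ (Φ.elems : Set (Fin d → ℝ)),
      t - s ∈ latticeOfSS Φ := by
  have hd' : (2 : ℝ) ≤ d := by exact_mod_cast hd
  have htspan : t ∈ Submodule.span ℝ (Φ.elems : Set (Fin d → ℝ)) := by
    rw [Φ.span_eq, V0sub]
    simpa using ht
  obtain ⟨c, -, hc⟩ := Submodule.mem_span_finset.1 htspan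
  have hne : Φ.elems.Nonempty := Finset.card_pos.1 (by rw [Φ.card_eq]; omega)
  obtain ⟨j, -, hj⟩ := exists_sum_fract_sub_le Φ.elems hne c
  rw [Φ.card_eq] at hj
  have hzero : ∑ v ∈ Φ.elems, v = 0 := Φ.sum_eq_zero
  set f := ∑ i ∈ Φ.elems, Int.fract (c i - c j) with hf
  set r : ℝ := ((d - 1 : ℝ) / 2 - f) / d with hr
  have hr0 : 0 ≤ r := div_nonneg (by linarith) (by linarith)
  set n : ℝ := (d - 1 : ℝ) / 2 with hn
  have hn0 : 0 < n := by rw [hn]; linarith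
  refine ⟨∑ v ∈ Φ.elems, (Int.fract (c v - c j) + r) • v, ?_, ?_⟩
  · refine ⟨∑ v ∈ Φ.elems, ((Int.fract (c v - c j) + r) / n) • v, ?_, ?_⟩
    · refine (convex_convexHull ℝ _).sum_mem (fun v _ => ?_) ?_
        fun v hv => subset_convexHull ℝ _ hv
      · exact div_nonneg (add_nonneg (Int.fract_nonneg _) hr0) hn0.le
      · rw [← Finset.sum_div, Finset.sum_add_distrib, ← hf, Finset.sum_const, Φ.card_eq,
          nsmul_eq_mul, hr, div_eq_one_iff_eq hn0.ne']
        field_simp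
        ring
    · simp only [Finset.smul_sum, smul_smul]
      refine Finset.sum_congr rfl fun v _ => ?_
      rw [mul_div_cancel₀ _ hn0.ne']
  · have hdiff : t - ∑ v ∈ Φ.elems, (Int.fract (c v - c j) + r) • v
        = ∑ v ∈ Φ.elems, ⌊c v - c j⌋ • v := by
      have hconst : ∑ v ∈ Φ.elems, (c j - r) • v = 0 := by
        rw [← Finset.smul_sum, hzero, smul_zero]
      rw [← hc, sub_eq_iff_eq_add, ← add_zero (∑ v ∈ Φ.elems, ⌊c v - c j⌋ • v), ← hconst,
        ← Finset.sum_add_distrib, ← Finset.sum_add_distrib]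
      refine Finset.sum_congr rfl fun v _ => ?_
      rw [← Int.cast_smul_eq_zsmul ℝ, Int.fract]
      module
    rw [hdiff]
    exact sum_mem fun v hv => zsmul_mem (AddSubgroup.subset_closure hv) _

lemma diagonal_mulVec_comp {d : ℕ} (ε δ s t : Fin d → ℝ) :
    (fun v => (Matrix.diagonal fun i => ε i * Real.exp (s i)).mulVec v) ∘
        (fun v => (Matrix.diagonal fun i => δ i * Real.exp (t i)).mulVec v)
      = fun v => (Matrix.diagonal fun i => (ε * δ) i * Real.exp ((s + t) i)).mulVec v := by
  funext v i
  simp only [Function.comp_apply, Matrix.mulVec_diagonal, Pi.mul_apply, Pi.add_apply,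
    Real.exp_add]
  ring

lemma mul_eq_one_or_neg_one {d : ℕ} {ε δ : Fin d → ℝ} (hε : ∀ i, ε i = 1 ∨ ε i = -1)
    (hδ : ∀ i, δ i = 1 ∨ δ i = -1) (i : Fin d) : (ε * δ) i = 1 ∨ (ε * δ) i = -1 := by
  rcases hε i with h | h <;> rcases hδ i with h' | h' <;> simp [h, h']

lemma mul_self_eq_one_of_sign {d : ℕ} {ε : Fin d → ℝ} (hε : ∀ i, ε i = 1 ∨ ε i = -1) :
    ε * ε = 1 := by
  funext i
  rcases hε i with h | h <;> simp [h]

lemma diagonal_mulVec_one_zero {d : ℕ} :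
    (fun v : Fin d → ℝ => (Matrix.diagonal fun i => (1 : Fin d → ℝ) i *
      Real.exp ((0 : Fin d → ℝ) i)).mulVec v) = id := by
  funext v i
  simp

/-- `φ(stab_{UA}(x))` is already a subgroup. -/
lemma coe_DeltaX (d : ℕ) (x : XSpace d) : (DeltaX d x : Set (Fin d → ℝ)) = stabSet d x := by
  refine Set.Subset.antisymm (fun t ht => ?_) AddSubgroup.subset_closure
  induction ht using AddSubgroup.closure_induction with
  | mem t ht => exact ht
  | zero =>
    refine ⟨by simp, 1, fun i => Or.inl rfl, ?_⟩
    rw [diagonal_mulVec_one_zero, Set.image_id]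
  | add s t _ _ hs ht =>
    obtain ⟨hs0, ε, hε, hs⟩ := hs
    obtain ⟨ht0, δ, hδ, ht⟩ := ht
    refine ⟨by simp [Finset.sum_add_distrib, hs0, ht0], ε * δ, mul_eq_one_or_neg_one hε hδ, ?_⟩
    rw [← diagonal_mulVec_comp, Set.image_comp, ht, hs]
  | neg t _ ht =>
    obtain ⟨ht0, ε, hε, ht⟩ := ht
    refine ⟨by simp [ht0], ε, hε, ?_⟩
    conv_lhs => rw [← ht]
    rw [← Set.image_comp, diagonal_mulVec_comp, mul_self_eq_one_of_sign hε, neg_add_cancel,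
      diagonal_mulVec_one_zero, Set.image_id]

lemma latticeOf_smul (d : ℕ) (g : SLR d) (x : XSpace d) :
    latticeOf d (g • x) = (fun v => (g : Matrix (Fin d) (Fin d) ℝ).mulVec v) '' latticeOf d x := by
  ext w
  constructor
  · rintro ⟨h, hh, v, rfl⟩
    refine ⟨_, ⟨g⁻¹ * h, ?_, v, rfl⟩, ?_⟩
    · rw [← smul_eq_mul, ← MulAction.Quotient.smul_mk, hh, inv_smul_smul]
    · simp only [Matrix.mulVec_mulVec]
      rw [← Matrix.SpecialLinearGroup.coe_mul, mul_inv_cancel_left]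
  · rintro ⟨_, ⟨h, rfl, v, rfl⟩, rfl⟩
    exact ⟨g * h, rfl, v, by simp [Matrix.mulVec_mulVec]⟩

theorem stmt16 (d : ℕ) (hd : 2 ≤ d) (x : XSpace d) (hx : IsCompact (Aorbit d x))
    (Φ : SimplexSet d) (hΦ : (Φ.elems : Set (Fin d → ℝ)) ⊆ (DeltaX d x : Set (Fin d → ℝ))) :
    ∀ (t : Fin d → ℝ) (ht : ∑ i, t i = 0),
      ∃ (ε : Fin d → ℝ) (s : Fin d → ℝ),
        (∀ i, ε i = 1 ∨ ε i = -1) ∧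
        s ∈ ((d - 1 : ℝ) / 2) • convexHull ℝ (Φ.elems : Set (Fin d → ℝ)) ∧
        latticeOf d (aSL d t ht • x) =
          (fun v => (Matrix.diagonal fun i => ε i * Real.exp (s i)).mulVec v) ''
            latticeOf d x := by
  intro t ht
  obtain ⟨s, hs, hts⟩ := Φ.exists_sub_mem_smul_convexHull hd ht
  have hmem : t - s ∈ (DeltaX d x : Set (Fin d → ℝ)) := (AddSubgroup.closure_le _).2 hΦ hts
  rw [coe_DeltaX] at hmem
  obtain ⟨-, ε, hε, hstab⟩ := hmem
  refine ⟨ε, s, hε, hs, ?_⟩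
  conv_rhs => rw [← hstab]
  rw [← Set.image_comp, diagonal_mulVec_comp, mul_self_eq_one_of_sign hε, add_sub_cancel,
    latticeOf_smul]
  simp [aSL]
end
end

section
/- There exists a constant c > 0 depending only on d such that for every x ∈ Ω and every simplex set Φ ⊆ Δ_x, the shortest nonzero vector of x satisfies ℓ(x) ≥ c e^{−(n/2)ξ_Φ}. -/
open scoped Pointwise

noncomputable section

theorem mem_latticeOf_mk (d : ℕ) (g : SLR d) (w : Fin d → ℝ) :
    w ∈ latticeOf d (QuotientGroup.mk g) ↔
      ∃ z : Fin d → ℤ, w = (g : Matrix (Fin d) (Fin d) ℝ).mulVec fun i => (z i : ℝ) := by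
  constructor
  · rintro ⟨g', hg', z, rfl⟩
    obtain ⟨γ, hγ⟩ := QuotientGroup.eq.mp hg'.symm
    refine ⟨(γ : Matrix (Fin d) (Fin d) ℤ).mulVec z, ?_⟩
    have h : g' = g * Matrix.SpecialLinearGroup.map (Int.castRingHom ℝ) γ := by
      rw [hγ]; group
    rw [h, Matrix.SpecialLinearGroup.coe_mul, ← Matrix.mulVec_mulVec]
    congr 1
    ext i
    simp [Matrix.mulVec, dotProduct]
  · rintro ⟨z, rfl⟩
    exact ⟨g, rfl, z, rfl⟩

/-- A proper subspace containing a vector without zero coordinates is not invariant under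
a set of coordinatewise multipliers that separates the coordinates. -/
theorem eq_top_of_mul_mem {d : ℕ} (S : Set (Fin d → ℝ))
    (hS : ∀ i j, (∀ u ∈ S, u i = u j) → i = j) (v : Fin d → ℝ) (hv : ∀ i, v i ≠ 0)
    (W : Submodule ℝ (Fin d → ℝ)) (hvW : v ∈ W) (hW : ∀ u ∈ S, ∀ w ∈ W, u * w ∈ W) :
    W = ⊤ := by
  by_contra hne
  obtain ⟨f, hf0, hf⟩ := Submodule.exists_le_ker_of_lt_top W (lt_top_iff_ne_top.mpr hne)
  have hM : ∀ m ∈ Submonoid.closure S, ∀ w ∈ W, m * w ∈ W := by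
    intro m hm
    induction hm using Submonoid.closure_induction with
    | mem u hu => exact hW u hu
    | one => intro w hw; simpa using hw
    | mul a b _ _ ha hb => intro w hw; rw [mul_assoc]; exact ha _ (hb _ hw)
  let χ : Fin d → (Submonoid.closure S →* ℝ) := fun i =>
    (Pi.evalMonoidHom (fun _ : Fin d => ℝ) i).comp (Submonoid.closure S).subtype
  have hχ : Function.Injective χ := by
    intro i j hij
    refine hS i j fun u hu => ?_
    exact DFunLike.congr_fun hij ⟨u, Submonoid.subset_closure hu⟩
  have hli := (linearIndependent_monoidHom (Submonoid.closure S) ℝ).comp χ hχ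
  rw [Fintype.linearIndependent_iff] at hli
  have hz := hli (fun i => f (Pi.single i 1) * v i) (by
    ext m
    have h0 : f ((m : Fin d → ℝ) * v) = 0 := hf (hM m m.2 v hvW)
    rw [LinearMap.pi_apply_eq_sum_univ f] at h0
    simp only [Finset.sum_apply, Pi.smul_apply, smul_eq_mul, Function.comp_apply, Pi.zero_apply]
    rw [← h0]
    refine Finset.sum_congr rfl fun i _ => ?_
    have h1 : (fun j => if i = j then (1 : ℝ) else 0) = Pi.single i 1 := by
      ext j; simp [Pi.single_apply, eq_comm]
    rw [h1]
    simp [χ]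
    ring)
  refine hf0 (LinearMap.pi_ext' fun i => LinearMap.ext_ring ?_)
  simpa [hv i] using hz i

theorem exists_multiplier_of_mem_DeltaX {d : ℕ} {x : XSpace d} {t : Fin d → ℝ}
    (ht : t ∈ DeltaX d x) :
    ∃ u : Fin d → ℝ, (∀ i, |u i| = Real.exp (t i)) ∧
      ∀ w, u * w ∈ latticeOf d x ↔ w ∈ latticeOf d x := by
  induction ht using AddSubgroup.closure_induction with
  | mem t ht =>
    obtain ⟨-, ε, hε, h⟩ := ht
    have hmul : ∀ w : Fin d → ℝ, (Matrix.diagonal fun i => ε i * Real.exp (t i)).mulVec w =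
        (fun i => ε i * Real.exp (t i)) * w := by
      intro w; ext i; simp [Matrix.mulVec_diagonal]
    simp only [hmul] at h
    have habs : ∀ i, |ε i * Real.exp (t i)| = Real.exp (t i) := by
      intro i; rcases hε i with h | h <;> simp [h]
    refine ⟨fun i => ε i * Real.exp (t i), habs, fun w => ⟨fun hw => ?_, fun hw => ?_⟩⟩
    · rw [← h] at hw
      obtain ⟨w', hw', he⟩ := hw
      have : w' = w := by
        ext i
        have h0 : ε i * Real.exp (t i) ≠ 0 := by
          rw [← abs_pos, habs]; exact Real.exp_pos _
        exact mul_left_cancel₀ h0 (congrFun he i)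
      exact this ▸ hw'
    · rw [← h]; exact ⟨w, hw, rfl⟩
  | zero => exact ⟨1, by simp, by simp⟩
  | add s t _ _ hs ht =>
    obtain ⟨u, hu, hu'⟩ := hs
    obtain ⟨v, hv, hv'⟩ := ht
    refine ⟨u * v, fun i => by simp [abs_mul, hu, hv, Real.exp_add], fun w => ?_⟩
    rw [mul_assoc, hu', hv']
  | neg t _ ht =>
    obtain ⟨u, hu, hu'⟩ := ht
    refine ⟨u⁻¹, fun i => by simp [abs_inv, hu, Real.exp_neg], fun w => ?_⟩
    rw [← hu']
    have : u * (u⁻¹ * w) = w := by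
      ext i
      have h0 : u i ≠ 0 := by rw [← abs_pos, hu]; exact Real.exp_pos _
      simp [h0]
    rw [this]

namespace SimplexSet

variable {d : ℕ} (Φ : SimplexSet d)

theorem sum_apply_eq_zero {t : Fin d → ℝ} (ht : t ∈ Φ.elems) : ∑ i, t i = 0 := by
  have h : t ∈ V0sub d := Φ.span_eq ▸ Submodule.subset_span ht
  simpa [V0sub] using h

theorem apply_le_xi {t : Fin d → ℝ} (ht : t ∈ Φ.elems) (i : Fin d) : t i ≤ xi Φ :=
  (le_ciSup (Set.finite_range t).bddAbove i).trans
    (le_csSup (Φ.elems.finite_toSet.image _).bddAbove ⟨t, ht, rfl⟩)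

theorem xi_nonneg (hd : 2 ≤ d) : 0 ≤ xi Φ := by
  obtain ⟨t, ht⟩ : Φ.elems.Nonempty := by
    rw [← Finset.card_pos, Φ.card_eq]; omega
  by_contra! hneg
  have : ∑ i, t i < 0 :=
    Finset.sum_neg (fun i _ => (Φ.apply_le_xi ht i).trans_lt hneg) ⟨⟨0, by omega⟩, by simp⟩
  rw [Φ.sum_apply_eq_zero ht] at this
  exact this.false

theorem eq_of_forall_apply_eq {i j : Fin d} (h : ∀ t ∈ Φ.elems, t i = t j) : i = j := by
  by_contra hij
  have hmem : (Pi.single i 1 - Pi.single j 1 : Fin d → ℝ) ∈ V0sub d := by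
    simp [V0sub, Finset.sum_sub_distrib]
  rw [← Φ.span_eq] at hmem
  have hle : Submodule.span ℝ (Φ.elems : Set (Fin d → ℝ)) ≤
      LinearMap.ker ((LinearMap.proj i : (Fin d → ℝ) →ₗ[ℝ] ℝ) - LinearMap.proj j) := by
    rw [Submodule.span_le]
    intro t ht
    simpa [sub_eq_zero] using h t ht
  have := hle hmem
  simp [hij, Ne.symm hij] at this

/-- The lattice generated by a simplex set meets every cone
`{s | s j < 0 for j ≠ i}`. -/
theorem exists_mem_latticeOfSS_forall_neg (i : Fin d) :
    ∃ s ∈ latticeOfSS Φ, ∀ j, j ≠ i → s j < 0 := by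
  let e : Fin d → ℝ := fun j => (if j = i then (d : ℝ) else 0) - 1
  have he : e ∈ Submodule.span ℝ (Φ.elems : Set (Fin d → ℝ)) := by
    rw [Φ.span_eq]
    simp [V0sub, e, Finset.sum_sub_distrib]
  obtain ⟨f, -, hf⟩ := Submodule.mem_span_finset.mp he
  obtain ⟨N, hN⟩ := exists_gt (∑ t ∈ Φ.elems, ‖t‖)
  refine ⟨∑ t ∈ Φ.elems, ⌊N * f t⌋ • t, ?_, fun j hj => ?_⟩
  · exact AddSubgroup.sum_mem _ fun t ht =>
      AddSubgroup.zsmul_mem _ (AddSubgroup.subset_closure ht) _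
  · have hfj : ∑ t ∈ Φ.elems, f t * t j = -1 := by
      have := congrFun hf j
      simpa [e, hj] using this
    have hterm : ∀ t ∈ Φ.elems, (⌊N * f t⌋ : ℝ) * t j ≤ N * (f t * t j) + ‖t‖ := by
      intro t _
      have h1 : |Int.fract (N * f t) * t j| ≤ 1 * ‖t‖ := by
        rw [abs_mul]
        gcongr
        · rw [abs_of_nonneg (Int.fract_nonneg _)]; exact (Int.fract_lt_one _).le
        · exact norm_le_pi_norm t j
      have h2 := neg_le_of_abs_le h1
      have h3 := Int.floor_add_fract (N * f t)
      have h4 : (⌊N * f t⌋ : ℝ) * t j = N * (f t * t j) - Int.fract (N * f t) * t j := by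
        linear_combination t j * h3
      linarith
    have hsum := Finset.sum_le_sum hterm
    rw [Finset.sum_add_distrib, ← Finset.mul_sum, hfj] at hsum
    have hs : (∑ t ∈ Φ.elems, ⌊N * f t⌋ • t) j = ∑ t ∈ Φ.elems, (⌊N * f t⌋ : ℝ) * t j := by
      rw [Finset.sum_apply]
      exact Finset.sum_congr rfl fun t _ => by rw [Pi.smul_apply, zsmul_eq_mul]
    rw [hs]
    linarith

end SimplexSet

/-- A nonzero lattice vector has no zero coordinates as soon as the stabilizer contains
a simplex set. -/
theorem apply_ne_zero_of_mem_latticeOf {d : ℕ} {x : XSpace d} (Φ : SimplexSet d)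
    (hΦ : (Φ.elems : Set (Fin d → ℝ)) ⊆ (DeltaX d x : Set (Fin d → ℝ)))
    {v : Fin d → ℝ} (hv : v ∈ latticeOf d x) (hv0 : v ≠ 0) (i : Fin d) : v i ≠ 0 := by
  intro hi
  obtain ⟨s, hs, hneg⟩ := Φ.exists_mem_latticeOfSS_forall_neg i
  have hs' : s ∈ DeltaX d x := (AddSubgroup.closure_le _).mpr hΦ hs
  obtain ⟨u, hu, huL⟩ := exists_multiplier_of_mem_DeltaX hs'
  obtain ⟨g, rfl⟩ := QuotientGroup.mk_surjective x
  have hpow : ∀ k : ℕ, u ^ k * v ∈ latticeOf d (QuotientGroup.mk g) := by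
    intro k
    induction k with
    | zero => simpa using hv
    | succ k ih => rw [pow_succ', mul_assoc]; exact (huL _).mpr ih
  have hlim : Filter.Tendsto (fun k : ℕ => u ^ k * v) Filter.atTop (nhds 0) := by
    rw [tendsto_pi_nhds]
    intro j
    by_cases hj : j = i
    · subst hj; simp [hi]
    · have h1 : |u j| < 1 := by rw [hu]; exact Real.exp_lt_one_iff.mpr (hneg j hj)
      simpa using (tendsto_pow_atTop_nhds_zero_of_abs_lt_one h1).mul_const (v j)
  choose z hz using fun k => (mem_latticeOf_mk d g _).mp (hpow k)
  have hinv : ∀ k, (fun j => (z k j : ℝ)) =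
      ((g⁻¹ : SLR d) : Matrix (Fin d) (Fin d) ℝ).mulVec (u ^ k * v) := by
    intro k
    rw [hz k, Matrix.mulVec_mulVec, ← Matrix.SpecialLinearGroup.coe_mul,
      inv_mul_cancel, Matrix.SpecialLinearGroup.coe_one, Matrix.one_mulVec]
  have hlim' : Filter.Tendsto (fun k : ℕ => fun j => (z k j : ℝ)) Filter.atTop (nhds 0) := by
    rw [funext hinv]
    have hc : Continuous fun w : Fin d → ℝ =>
        ((g⁻¹ : SLR d) : Matrix (Fin d) (Fin d) ℝ).mulVec w := by fun_prop
    simpa only [Function.comp_def, Matrix.mulVec_zero] using (hc.tendsto 0).comp hlim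
  have hev := (Metric.tendsto_nhds.mp hlim') 1 one_pos
  obtain ⟨k, hk⟩ := hev.exists
  rw [dist_zero_right] at hk
  have hzk : ∀ j, z k j = 0 := by
    intro j
    have h1 := (norm_le_pi_norm (fun j => (z k j : ℝ)) j).trans_lt hk
    rw [Real.norm_eq_abs] at h1
    exact Int.abs_lt_one_iff.mp (by exact_mod_cast h1)
  have h0 : u ^ k * v = 0 := by
    rw [hz k]; simp [hzk, Matrix.mulVec, dotProduct, funext_iff]
  refine hv0 (funext fun j => ?_)
  have h1 : u j ≠ 0 := by rw [← abs_pos, hu]; exact Real.exp_pos _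
  have := congrFun h0 j
  simpa [h1] using this

theorem exists_linearIndependent_latticeOf {d : ℕ} (hd : 2 ≤ d) {x : XSpace d}
    (Φ : SimplexSet d)
    (hΦ : (Φ.elems : Set (Fin d → ℝ)) ⊆ (DeltaX d x : Set (Fin d → ℝ)))
    {v : Fin d → ℝ} (hv : v ∈ latticeOf d x) (hv0 : v ≠ 0) (k : ℕ) (hk : k + 1 ≤ d) :
    ∃ w : Fin (k + 1) → Fin d → ℝ, LinearIndependent ℝ w ∧ w 0 = v ∧
      ∀ j, w j ∈ latticeOf d x ∧ ‖w j‖ ≤ Real.exp (j * xi Φ) * ‖v‖ := by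
  choose! u hu huL using fun t (ht : t ∈ Φ.elems) => exists_multiplier_of_mem_DeltaX (hΦ ht)
  have hnz := apply_ne_zero_of_mem_latticeOf Φ hΦ hv hv0
  induction k with
  | zero =>
    have : Subsingleton (Fin (0 + 1)) := Fin.subsingleton_one
    refine ⟨fun _ => v, ?_, rfl, fun j => ⟨hv, ?_⟩⟩
    · exact LinearIndependent.of_subsingleton 0 hv0
    · simp [Subsingleton.elim j 0]
  | succ k ih =>
    obtain ⟨w, hw, hw0, hwb⟩ := ih (by omega)
    obtain ⟨t, ht, j, hj⟩ : ∃ t ∈ Φ.elems, ∃ j, u t * w j ∉ Submodule.span ℝ (Set.range w) := by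
      by_contra! hcon
      have htop : Submodule.span ℝ (Set.range w) = ⊤ := by
        refine eq_top_of_mul_mem (u '' Φ.elems) ?_ v hnz _
          (hw0 ▸ Submodule.subset_span ⟨0, rfl⟩) ?_
        · intro i j hij
          refine Φ.eq_of_forall_apply_eq fun t ht => Real.exp_injective ?_
          rw [← hu t ht, ← hu t ht, hij _ ⟨t, ht, rfl⟩]
        · rintro _ ⟨t, ht, rfl⟩ y hy
          have hle : Submodule.span ℝ (Set.range w) ≤
              (Submodule.span ℝ (Set.range w)).comap (LinearMap.mulLeft ℝ (u t)) := by
            rw [Submodule.span_le]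
            rintro _ ⟨j, rfl⟩
            exact hcon t ht j
          exact hle hy
      have hc := finrank_span_eq_card hw
      rw [htop, finrank_top] at hc
      simp at hc
      omega
    refine ⟨Fin.snoc (α := fun _ => Fin d → ℝ) w (u t * w j),
      linearIndependent_finSnoc.mpr ⟨hw, hj⟩, ?_, ?_⟩
    · rw [← hw0, ← Fin.castSucc_zero, Fin.snoc_castSucc]
    · intro l
      induction l using Fin.lastCases with
      | cast l => rw [Fin.snoc_castSucc]; simpa using hwb l
      | last =>
        rw [Fin.snoc_last]
        refine ⟨(huL t ht _).mpr (hwb j).1, ?_⟩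
        have hut : ‖u t‖ ≤ Real.exp (xi Φ) := by
          rw [pi_norm_le_iff_of_nonneg (Real.exp_pos _).le]
          intro i
          rw [Real.norm_eq_abs, hu t ht]
          exact Real.exp_le_exp.mpr (Φ.apply_le_xi ht i)
        have hjk : (j : ℝ) ≤ k := by exact_mod_cast Nat.lt_succ_iff.mp j.2
        calc ‖u t * w j‖ ≤ ‖u t‖ * ‖w j‖ := norm_mul_le _ _
          _ ≤ Real.exp (xi Φ) * (Real.exp (j * xi Φ) * ‖v‖) := by
              gcongr
              exact (hwb j).2
          _ = Real.exp ((j + 1) * xi Φ) * ‖v‖ := by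
              rw [← mul_assoc, ← Real.exp_add]; congr 2; ring
          _ ≤ Real.exp ((Fin.last (k + 1) : ℕ) * xi Φ) * ‖v‖ := by
              have := Φ.xi_nonneg hd
              simp only [Fin.val_last, Nat.cast_add, Nat.cast_one]
              gcongr

theorem abs_det_le_factorial_mul_prod {d : ℕ} (w : Matrix (Fin d) (Fin d) ℝ) :
    |w.det| ≤ d.factorial * ∏ i, ‖w i‖ := by
  rw [← Matrix.det_transpose, Matrix.det_apply]
  refine (Finset.abs_sum_le_sum_abs _ _).trans ?_
  have : ∀ σ ∈ (Finset.univ : Finset (Equiv.Perm (Fin d))),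
      |Equiv.Perm.sign σ • ∏ i, w.transpose (σ i) i| ≤ ∏ i, ‖w i‖ := by
    intro σ _
    rw [Units.smul_def, zsmul_eq_mul, abs_mul, ← Int.cast_abs,
      Int.isUnit_iff_abs_eq.mp (Units.isUnit _), Int.cast_one, one_mul, Finset.abs_prod]
    exact Finset.prod_le_prod (fun _ _ => abs_nonneg _) fun i _ => norm_le_pi_norm (w i) (σ i)
  refine (Finset.sum_le_sum this).trans_eq ?_
  simp [Finset.card_univ, Fintype.card_perm]

theorem one_le_abs_det_of_mem_latticeOf {d : ℕ} {x : XSpace d} (w : Matrix (Fin d) (Fin d) ℝ)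
    (hw : ∀ i, w i ∈ latticeOf d x) (hli : LinearIndependent ℝ w) : 1 ≤ |w.det| := by
  obtain ⟨g, rfl⟩ := QuotientGroup.mk_surjective x
  choose z hz using fun i => (mem_latticeOf_mk d g _).mp (hw i)
  have hwz : w = (Matrix.of z).map (Int.castRingHom ℝ) *
      (g : Matrix (Fin d) (Fin d) ℝ).transpose := by
    ext i j
    rw [hz i]
    simp [Matrix.mul_apply, Matrix.mulVec, dotProduct, mul_comm]
  have hdet : w.det = ((Matrix.of z).det : ℝ) := by
    rw [hwz, Matrix.det_mul, Matrix.det_transpose, g.det_coe, mul_one]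
    exact (RingHom.map_det (Int.castRingHom ℝ) (Matrix.of z)).symm
  have hne : w.det ≠ 0 := by
    have := Matrix.linearIndependent_rows_iff_isUnit.mp hli
    exact ((Matrix.isUnit_iff_isUnit_det _).mp this).ne_zero
  rw [hdet] at hne ⊢
  exact_mod_cast Int.one_le_abs (by exact_mod_cast hne)

theorem latticeOf_exists_ne_zero {d : ℕ} (hd : 2 ≤ d) (x : XSpace d) :
    ∃ w ∈ latticeOf d x, w ≠ 0 := by
  obtain ⟨g, rfl⟩ := QuotientGroup.mk_surjective x
  refine ⟨_, (mem_latticeOf_mk d g _).mpr ⟨fun _ => 1, rfl⟩, fun h => ?_⟩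
  have h1 := congrArg ((g⁻¹ : SLR d) : Matrix (Fin d) (Fin d) ℝ).mulVec h
  rw [Matrix.mulVec_mulVec, ← Matrix.SpecialLinearGroup.coe_mul] at h1
  have := congrFun h1 ⟨0, by omega⟩
  simp at this

theorem stmt17 (d : ℕ) (hd : 2 ≤ d) :
    ∃ c : ℝ, 0 < c ∧ ∀ x : XSpace d, IsCompact (Aorbit d x) →
      ∀ Φ : SimplexSet d, (Φ.elems : Set (Fin d → ℝ)) ⊆ (DeltaX d x : Set (Fin d → ℝ)) →
        c * Real.exp (-((d - 1 : ℝ) / 2) * xi Φ) ≤ shortest d x := by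
  have hfac : (0 : ℝ) < d.factorial := by exact_mod_cast d.factorial_pos
  refine ⟨(d.factorial : ℝ)⁻¹, inv_pos.mpr hfac, fun x _ Φ hΦ => ?_⟩
  obtain ⟨v₀, hv₀, hv₀'⟩ := latticeOf_exists_ne_zero hd x
  refine le_csInf ⟨_, v₀, hv₀, hv₀', rfl⟩ ?_
  rintro _ ⟨v, hv, hv0, rfl⟩
  obtain ⟨n, rfl⟩ : ∃ n, d = n + 1 := ⟨d - 1, by omega⟩
  obtain ⟨w, hli, -, hw⟩ := exists_linearIndependent_latticeOf hd Φ hΦ hv hv0 n le_rfl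
  have h1 := one_le_abs_det_of_mem_latticeOf (Matrix.of w) (fun i => (hw i).1) hli
  have h2 := abs_det_le_factorial_mul_prod (Matrix.of w)
  have h3 : ∏ i, ‖(Matrix.of w) i‖ ≤ ∏ i : Fin (n + 1), (Real.exp (i * xi Φ) * ‖v‖) :=
    Finset.prod_le_prod (fun _ _ => norm_nonneg _) fun i _ => (hw i).2
  have hsum : ∑ i : Fin (n + 1), (i : ℝ) = (n + 1) * n / 2 := by
    rw [Fin.sum_univ_eq_sum_range (fun i => (i : ℝ)) (n + 1), eq_div_iff two_ne_zero]
    have := Finset.sum_range_id_mul_two (n + 1)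
    rw [Nat.add_sub_cancel] at this
    rw [← Nat.cast_sum]
    exact_mod_cast this
  rw [Finset.prod_mul_distrib, ← Real.exp_sum, ← Finset.sum_mul, hsum, Finset.prod_const,
    Finset.card_univ, Fintype.card_fin] at h3
  set E := Real.exp (((n : ℝ) + 1) * n / 2 * xi Φ) with hE
  have hEpos : 0 < E := Real.exp_pos _
  have h4 : 1 ≤ ((n + 1).factorial : ℝ) * (E * ‖v‖ ^ (n + 1)) :=
    h1.trans (h2.trans (by gcongr))
  refine le_of_pow_le_pow_left₀ n.succ_ne_zero (norm_nonneg v) ?_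
  have hexp : Real.exp (-((((n + 1 : ℕ) : ℝ) - 1) / 2) * xi Φ) ^ (n + 1) = E⁻¹ := by
    rw [← Real.exp_nat_mul, hE, ← Real.exp_neg]
    congr 1
    push_cast
    ring
  have hle1 : ((n + 1).factorial : ℝ)⁻¹ ≤ 1 :=
    inv_le_one_of_one_le₀ (by exact_mod_cast (n + 1).factorial_pos)
  rw [mul_pow, hexp]
  calc (((n + 1).factorial : ℝ)⁻¹) ^ (n + 1) * E⁻¹
      ≤ ((n + 1).factorial : ℝ)⁻¹ * E⁻¹ := by
        gcongr
        exact pow_le_of_le_one (inv_nonneg.mpr hfac.le) hle1 n.succ_ne_zero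
    _ ≤ ‖v‖ ^ (n + 1) := by
        rw [← mul_inv, inv_le_iff_one_le_mul₀ (by positivity)]
        linarith
end
end

section
/- For every M > 0 and every compact set K of shapes there exists T = T(M,K) > 0 such that: if x ∈ Ω_{M,K} and Φ ⊆ Δ_x is any M-tight simplex set for x, then the distortion of Φ satisfies ‖h_Φ‖ ≤ T. -/
open scoped Pointwise

noncomputable section

theorem latticeOf_mk {d : ℕ} (g : SLR d) :
    latticeOf d (QuotientGroup.mk g) = Set.range fun z : Fin d → ℤ =>
      (g : Matrix (Fin d) (Fin d) ℝ).mulVec fun i => (z i : ℝ) := by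
  ext w
  constructor
  · rintro ⟨g', h, z, rfl⟩
    obtain ⟨γ, hγ⟩ := QuotientGroup.eq.1 h.symm
    have hg' : g' = g * Matrix.SpecialLinearGroup.map (Int.castRingHom ℝ) γ := by
      rw [hγ]; group
    refine ⟨(γ : Matrix (Fin d) (Fin d) ℤ).mulVec z, ?_⟩
    have hz : (fun i => (((γ : Matrix (Fin d) (Fin d) ℤ).mulVec z i : ℤ) : ℝ)) =
        (Matrix.SpecialLinearGroup.map (Int.castRingHom ℝ) γ : SLR d).1.mulVec
          fun i => (z i : ℝ) := by
      ext i
      simp [Matrix.mulVec, dotProduct]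
    simp only [hz, Matrix.mulVec_mulVec]
    rw [hg']
    rfl
  · rintro ⟨z, rfl⟩
    exact ⟨g, rfl, z, rfl⟩

theorem mem_stabSet_iff {d : ℕ} {x : XSpace d} {t : Fin d → ℝ} :
    t ∈ stabSet d x ↔ ∑ i, t i = 0 ∧ ∃ u : Fin d → ℝ, (∀ i, |u i| = Real.exp (t i)) ∧
      (fun v => u * v) '' latticeOf d x = latticeOf d x := by
  have hdiag (u : Fin d → ℝ) : (fun v => (Matrix.diagonal u).mulVec v) = fun v => u * v := by
    ext v i
    simp [Matrix.mulVec_diagonal]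
  constructor
  · rintro ⟨h0, ε, hε, h⟩
    refine ⟨h0, fun i => ε i * Real.exp (t i), fun i => ?_, ?_⟩
    · rcases hε i with h | h <;> simp [h]
    · rw [← hdiag]; exact h
  · rintro ⟨h0, u, hu, h⟩
    refine ⟨h0, fun i => u i / Real.exp (t i), fun i => ?_, ?_⟩
    · show u i / Real.exp (t i) = 1 ∨ u i / Real.exp (t i) = -1
      rw [← hu i]
      have : u i ≠ 0 := by
        intro h; have := hu i; rw [h, abs_zero] at this; exact (Real.exp_pos _).ne this
      rcases abs_choice (u i) with h | h <;> rw [h]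
      · exact Or.inl (div_self this)
      · exact Or.inr (by rw [div_neg, div_self this])
    · simp only [div_mul_cancel₀ _ (Real.exp_ne_zero _)]
      rw [hdiag]; exact h

theorem mem_stabSet_of_mem_DeltaX {d : ℕ} {x : XSpace d} {t : Fin d → ℝ} (ht : t ∈ DeltaX d x) :
    t ∈ stabSet d x := by
  induction ht using AddSubgroup.closure_induction with
  | mem t h => exact h
  | zero => exact mem_stabSet_iff.2 ⟨by simp, 1, by simp, by simp⟩
  | add s t _ _ hs ht =>
    obtain ⟨hs0, u, hu, hL⟩ := mem_stabSet_iff.1 hs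
    obtain ⟨ht0, u', hu', hL'⟩ := mem_stabSet_iff.1 ht
    refine mem_stabSet_iff.2 ⟨by simp [Finset.sum_add_distrib, hs0, ht0], u * u', fun i => ?_, ?_⟩
    · simp [abs_mul, hu, hu', Real.exp_add]
    · conv_rhs => rw [← hL, ← hL', Set.image_image]
      simp only [mul_assoc]
  | neg t _ ht =>
    obtain ⟨ht0, u, hu, hL⟩ := mem_stabSet_iff.1 ht
    have hu0 (i) : u i ≠ 0 := by
      intro h; have := hu i; rw [h, abs_zero] at this; exact (Real.exp_pos _).ne this
    refine mem_stabSet_iff.2 ⟨by simp [ht0], u⁻¹, fun i => ?_, ?_⟩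
    · simp [abs_inv, hu, Real.exp_neg]
    · conv_lhs => rw [← hL, Set.image_image]
      have : (fun v => u⁻¹ * (u * v)) = id := by
        ext v i
        simp [hu0 i]
      rw [this, Set.image_id]

/-- Every vector of `Δ_x` comes from a diagonal stabilizer of `x`. -/
theorem exists_multiplier {d : ℕ} {x : XSpace d} {t : Fin d → ℝ} (ht : t ∈ DeltaX d x) :
    ∃ u : Fin d → ℝ, (∀ i, |u i| = Real.exp (t i)) ∧
      ∀ w ∈ latticeOf d x, u * w ∈ latticeOf d x := by
  obtain ⟨-, u, hu, hL⟩ := mem_stabSet_iff.1 (mem_stabSet_of_mem_DeltaX ht)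
  exact ⟨u, hu, fun w hw => hL ▸ Set.mem_image_of_mem _ hw⟩

theorem one_le_abs_det {d : ℕ} {x : XSpace d} {w : Fin d → Fin d → ℝ}
    (hw : ∀ i, w i ∈ latticeOf d x) (h0 : (Matrix.of w).det ≠ 0) : 1 ≤ |(Matrix.of w).det| := by
  obtain ⟨g, rfl⟩ := QuotientGroup.mk_surjective x
  simp only [latticeOf_mk] at hw
  choose z hz using hw
  have : (Matrix.of w) = ((Matrix.of z).map (Int.cast : ℤ → ℝ)) *
      (g : Matrix (Fin d) (Fin d) ℝ).transpose := by
    ext i j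
    rw [Matrix.of_apply, ← hz i]
    simp [Matrix.mulVec, dotProduct, Matrix.mul_apply, mul_comm]
  have hdet : (Matrix.of w).det = ((Matrix.of z).det : ℝ) := by
    rw [this, Matrix.det_mul, Matrix.det_transpose, g.2, mul_one, Int.cast_det]
  rw [hdet] at h0 ⊢
  rw [← Int.cast_abs]
  exact_mod_cast Int.one_le_abs (by exact_mod_cast h0)

theorem abs_det_le {d : ℕ} (w : Fin d → Fin d → ℝ) :
    |(Matrix.of w).det| ≤ (d.factorial : ℝ) * ∏ i, ‖w i‖ := by
  rw [Matrix.det_apply']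
  refine (Finset.abs_sum_le_sum_abs _ _).trans ?_
  have h (σ : Equiv.Perm (Fin d)) :
      |((Equiv.Perm.sign σ : ℤ) : ℝ) * ∏ i, Matrix.of w (σ i) i| ≤ ∏ i, ‖w i‖ := by
    rw [abs_mul, ← Int.cast_abs, Int.isUnit_iff_abs_eq.1 (Units.isUnit _), Int.cast_one, one_mul,
      Finset.abs_prod, ← Equiv.prod_comp σ fun i => ‖w i‖]
    exact Finset.prod_le_prod (fun _ _ => abs_nonneg _) fun i _ => norm_le_pi_norm (w (σ i)) i
  refine (Finset.sum_le_sum fun σ _ => h σ).trans ?_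
  simp [Fintype.card_perm]

theorem exists_pos_le_norm {d : ℕ} (x : XSpace d) :
    ∃ r > 0, ∀ w ∈ latticeOf d x, w ≠ 0 → r ≤ ‖w‖ := by
  obtain ⟨g, rfl⟩ := QuotientGroup.mk_surjective x
  obtain ⟨C, hC, hb⟩ := (LinearMap.toContinuousLinearMap
    (Matrix.mulVecLin ((g⁻¹ : SLR d) : Matrix (Fin d) (Fin d) ℝ))).bound
  refine ⟨C⁻¹, inv_pos.2 hC, ?_⟩
  rw [latticeOf_mk]
  rintro _ ⟨z, rfl⟩ hz
  have hz0 : z ≠ 0 := by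
    rintro rfl
    apply hz
    ext i
    simp [Matrix.mulVec, dotProduct]
  obtain ⟨i, hi⟩ := Function.ne_iff.1 hz0
  have h1 := hb ((g : Matrix (Fin d) (Fin d) ℝ).mulVec fun i => (z i : ℝ))
  have h2 : (LinearMap.toContinuousLinearMap
      (Matrix.mulVecLin ((g⁻¹ : SLR d) : Matrix (Fin d) (Fin d) ℝ)))
      ((g : Matrix (Fin d) (Fin d) ℝ).mulVec fun i => (z i : ℝ)) = fun i => (z i : ℝ) := by
    have : ((g⁻¹ : SLR d) : Matrix (Fin d) (Fin d) ℝ) * (g : Matrix (Fin d) (Fin d) ℝ) = 1 := by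
      rw [← Matrix.SpecialLinearGroup.coe_mul, inv_mul_cancel, Matrix.SpecialLinearGroup.coe_one]
    simp only [LinearMap.coe_toContinuousLinearMap', Matrix.mulVecLin_apply, Matrix.mulVec_mulVec,
      this, Matrix.one_mulVec]
  rw [h2] at h1
  have h3 : (1 : ℝ) ≤ ‖fun i => (z i : ℝ)‖ := by
    refine le_trans ?_ (norm_le_pi_norm (fun i => (z i : ℝ)) i)
    rw [Real.norm_eq_abs, ← Int.cast_abs]
    exact_mod_cast Int.one_le_abs hi
  rw [inv_le_iff_one_le_mul₀' hC]
  exact h3.trans h1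

theorem exists_short_vector {d : ℕ} (hd : 2 ≤ d) {x : XSpace d} {r : ℝ} (h : shortest d x < r) :
    ∃ v ∈ latticeOf d x, v ≠ 0 ∧ ‖v‖ < r := by
  have hne : {r | ∃ w ∈ latticeOf d x, w ≠ 0 ∧ r = ‖w‖}.Nonempty := by
    obtain ⟨g, rfl⟩ := QuotientGroup.mk_surjective x
    refine ⟨_, (g : Matrix (Fin d) (Fin d) ℝ).mulVec fun _ => ((1 : ℤ) : ℝ),
      ⟨g, rfl, fun _ => 1, rfl⟩, fun h0 => ?_, rfl⟩
    have := Matrix.eq_zero_of_mulVec_eq_zero (by rw [g.2]; exact one_ne_zero) h0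
    simpa using congrFun this ⟨0, by lia⟩
  obtain ⟨_, ⟨w, hw, hw0, rfl⟩, hlt⟩ := exists_lt_of_csInf_lt hne h
  exact ⟨w, hw, hw0, hlt⟩

theorem bstar_eq {d : ℕ} (j : Fin d) : bstar d j = 1 - Pi.single j (d : ℝ) := by
  ext i
  by_cases h : i = j
  · subst h; simp [bstar]
  · simp [bstar, h]

theorem sum_bstar {d : ℕ} (j : Fin d) : ∑ i, bstar d j i = 0 := by
  simp [bstar_eq, Finset.sum_sub_distrib]

theorem exists_intMatrix_charpoly {d : ℕ} {x : XSpace d} {u : Fin d → ℝ}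
    (hu : ∀ w ∈ latticeOf d x, u * w ∈ latticeOf d x) :
    ∃ A : Matrix (Fin d) (Fin d) ℤ, A.charpoly.map (Int.castRingHom ℝ) =
      ∏ i, (Polynomial.X - Polynomial.C (u i)) := by
  obtain ⟨g, rfl⟩ := QuotientGroup.mk_surjective x
  simp only [latticeOf_mk] at hu
  have h (k : Fin d) := hu _ ⟨Pi.single k 1, rfl⟩
  choose z hz using h
  have hcol (k i : Fin d) :
      ∑ j, (g : Matrix (Fin d) (Fin d) ℝ) i j * (z k j : ℝ) =
        u i * (g : Matrix (Fin d) (Fin d) ℝ) i k := by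
    have := congrFun (hz k) i
    simpa [Matrix.mulVec, dotProduct, Pi.single_apply] using this
  let A : Matrix (Fin d) (Fin d) ℤ := (Matrix.of z).transpose
  have hA : (g : Matrix (Fin d) (Fin d) ℝ) * A.map (Int.castRingHom ℝ) =
      Matrix.diagonal u * (g : Matrix (Fin d) (Fin d) ℝ) := by
    ext i k
    rw [Matrix.diagonal_mul, Matrix.mul_apply]
    exact hcol k i
  have hg : (g : Matrix (Fin d) (Fin d) ℝ) * ((g⁻¹ : SLR d) : Matrix (Fin d) (Fin d) ℝ) = 1 := by
    rw [← Matrix.SpecialLinearGroup.coe_mul, mul_inv_cancel, Matrix.SpecialLinearGroup.coe_one]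
  have hg' : ((g⁻¹ : SLR d) : Matrix (Fin d) (Fin d) ℝ) * (g : Matrix (Fin d) (Fin d) ℝ) = 1 := by
    rw [← Matrix.SpecialLinearGroup.coe_mul, inv_mul_cancel, Matrix.SpecialLinearGroup.coe_one]
  refine ⟨A, ?_⟩
  rw [← Matrix.charpoly_map, ← Matrix.charpoly_diagonal]
  calc (A.map (Int.castRingHom ℝ)).charpoly
      = (((g⁻¹ : SLR d) : Matrix (Fin d) (Fin d) ℝ) *
          (Matrix.diagonal u * (g : Matrix (Fin d) (Fin d) ℝ))).charpoly := by
        rw [← hA, ← mul_assoc, hg', one_mul]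
    _ = (Matrix.diagonal u).charpoly := by
        rw [Matrix.charpoly_mul_comm, mul_assoc, hg, mul_one]

/-- Only finitely many vectors of bounded norm occur in the lattices `Δ_x`. -/
theorem finite_bounded_mem_DeltaX (d : ℕ) (R : ℝ) :
    {t : Fin d → ℝ | (∃ x, t ∈ DeltaX d x) ∧ ‖t‖ ≤ R}.Finite := by
  set B := Real.exp R
  set C := Nat.ceil (max B 1 ^ d * d.choose (d / 2))
  have hfin := Polynomial.bUnion_roots_finite (Int.castRingHom ℝ) d (Set.finite_Icc (-C : ℤ) C)
  refine (Set.Finite.pi' fun _ : Fin d => hfin.image Real.log).subset ?_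
  rintro t ⟨⟨x, hx⟩, htR⟩ i
  obtain ⟨u, hu, hL⟩ := exists_multiplier hx
  obtain ⟨A, hA⟩ := exists_intMatrix_charpoly hL
  have hroots : (A.charpoly.map (Int.castRingHom ℝ)).roots = Finset.univ.val.map u := by
    rw [hA, ← Polynomial.roots_multiset_prod_X_sub_C (Finset.univ.val.map u), Multiset.map_map]
    rfl
  refine ⟨u i, ?_, by rw [← Real.log_abs, hu, Real.log_exp]⟩
  have hdeg : A.charpoly.natDegree ≤ d := by
    rw [Matrix.charpoly_natDegree_eq_dim, Fintype.card_fin]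
  simp only [Set.mem_iUnion]
  refine ⟨A.charpoly, ⟨hdeg, fun k => ?_⟩, ?_⟩
  · have hsplit : (A.charpoly.map (Int.castRingHom ℝ)).Splits := by
      rw [hA]; exact Polynomial.Splits.prod fun i _ => Polynomial.Splits.X_sub_C _
    have hbound := Polynomial.coeff_bdd_of_roots_le (B := B) (d := d) (RingHom.id ℝ)
      (p := A.charpoly.map (Int.castRingHom ℝ)) ((Matrix.charpoly_monic A).map _)
      (by rwa [Polynomial.map_id]) (Polynomial.natDegree_map_le.trans hdeg) (fun r hr => by
        rw [Polynomial.map_id, hroots, Multiset.mem_map] at hr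
        obtain ⟨j, -, rfl⟩ := hr
        rw [Real.norm_eq_abs, hu]
        exact Real.exp_le_exp.2 ((le_abs_self _).trans ((norm_le_pi_norm t j).trans htR))) k
    rw [Polynomial.map_id, Polynomial.coeff_map, Real.norm_eq_abs] at hbound
    have := abs_le.1 (hbound.trans (Nat.le_ceil _))
    simp only [eq_intCast] at this
    exact ⟨by exact_mod_cast this.1, by exact_mod_cast this.2⟩
  · rw [Finset.mem_coe, Multiset.mem_toFinset, hroots]
    exact Multiset.mem_map_of_mem _ (Finset.mem_univ i)

theorem exists_ne_coord {d : ℕ} {ι : Type*} {t : ι → Fin d → ℝ}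
    (hspan : Submodule.span ℝ (Set.range t) = V0sub d) {j k : Fin d} (hjk : j ≠ k) :
    ∃ a, t a j ≠ t a k := by
  by_contra! h
  have hle : Submodule.span ℝ (Set.range t) ≤
      LinearMap.ker ((LinearMap.proj j : (Fin d → ℝ) →ₗ[ℝ] ℝ) - LinearMap.proj k) := by
    rw [Submodule.span_le]
    rintro _ ⟨a, rfl⟩
    simp [h a]
  have hmem : (Pi.single j 1 - Pi.single k 1 : Fin d → ℝ) ∈ V0sub d := by
    simp [V0sub, LinearMap.sum_apply, Finset.sum_sub_distrib]
  have := hle (hspan ▸ hmem)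
  simp [hjk, hjk.symm] at this

theorem eq_top_of_invariant {d : ℕ} {ι : Type*} [Nonempty ι] {u : ι → Fin d → ℝ}
    (hsep : ∀ j k, j ≠ k → ∃ a, u a j ≠ u a k) {W : Submodule ℝ (Fin d → ℝ)}
    (hW : ∀ a, ∀ w ∈ W, u a * w ∈ W) {v : Fin d → ℝ} (hv : v ∈ W) (hv0 : ∀ i, v i ≠ 0) :
    W = ⊤ := by
  have hsingle (j : Fin d) : (Pi.single j 1 : Fin d → ℝ) ∈ W := by
    choose! a ha using hsep j
    have hprod (s : Finset (Fin d)) :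
        (fun i => (∏ k ∈ s, (u (a k) i - u (a k) k)) * v i) ∈ W := by
      induction s using Finset.induction_on with
      | empty => simpa using hv
      | insert k s hk ih =>
        have := W.sub_mem (hW (a k) _ ih) (W.smul_mem (u (a k) k) ih)
        convert this using 1
        ext i
        simp only [Finset.prod_insert hk, Pi.sub_apply, Pi.mul_apply, Pi.smul_apply, smul_eq_mul]
        ring
    have h := W.smul_mem ((∏ k ∈ Finset.univ.erase j, (u (a k) j - u (a k) k)) * v j)⁻¹
      (hprod (Finset.univ.erase j))
    convert h using 1
    ext i
    by_cases hij : i = j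
    · subst hij
      have : (∏ k ∈ Finset.univ.erase i, (u (a k) i - u (a k) k)) * v i ≠ 0 :=
        mul_ne_zero (Finset.prod_ne_zero_iff.2 fun k hk =>
          sub_ne_zero.2 (ha k (Finset.ne_of_mem_erase hk).symm)) (hv0 i)
      rw [Pi.smul_apply, smul_eq_mul, inv_mul_cancel₀ this, Pi.single_eq_same]
    · have : ∏ k ∈ Finset.univ.erase j, (u (a k) i - u (a k) k) = 0 :=
        Finset.prod_eq_zero (Finset.mem_erase.2 ⟨hij, Finset.mem_univ i⟩) (sub_self _)
      simp [this, hij]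
  rw [eq_top_iff]
  intro w _
  rw [pi_eq_sum_univ' w]
  exact W.sum_mem fun i _ => W.smul_mem _ (by convert hsingle i using 1)

theorem exists_linearIndependent_chain {d : ℕ} {ι : Type*} [Nonempty ι] {u : ι → Fin d → ℝ}
    (hsep : ∀ j k, j ≠ k → ∃ a, u a j ≠ u a k) {L : Set (Fin d → ℝ)}
    (hL : ∀ a, ∀ w ∈ L, u a * w ∈ L) {E B : ℝ} (hE : 1 ≤ E) (hu : ∀ a, ‖u a‖ ≤ E)
    {v : Fin d → ℝ} (hv : v ∈ L) (hv0 : ∀ i, v i ≠ 0) (hvB : ‖v‖ ≤ B) {a b : ι}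
    (hab : LinearIndependent ℝ ![v, u a * v, u b * v]) (k : ℕ) (hk : 3 + k ≤ d) :
    ∃ w : Fin (3 + k) → Fin d → ℝ, LinearIndependent ℝ w ∧
      v ∈ Submodule.span ℝ (Set.range w) ∧ (∀ i, w i ∈ L) ∧ (∀ i, ‖w i‖ ≤ E ^ (1 + k) * B) ∧
      ∃ s : ℕ, 2 * s = 4 + k * (k + 3) ∧ ∏ i, ‖w i‖ ≤ E ^ s * B ^ (3 + k) := by
  have hB : 0 ≤ B := (norm_nonneg v).trans hvB
  have hmul (a : ι) {w : Fin d → ℝ} {c : ℝ} (hw : ‖w‖ ≤ c) : ‖u a * w‖ ≤ E * c :=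
    (norm_mul_le _ _).trans (mul_le_mul (hu a) hw (norm_nonneg _) (by linarith))
  induction k with
  | zero =>
    refine ⟨![v, u a * v, u b * v], hab, Submodule.subset_span ⟨0, rfl⟩, fun i => ?_,
      fun i => ?_, 2, rfl, ?_⟩
    · fin_cases i
      exacts [hv, hL a v hv, hL b v hv]
    · fin_cases i
      · simpa using hvB.trans (le_mul_of_one_le_left hB hE)
      · simpa using hmul a hvB
      · simpa using hmul b hvB
    · calc ∏ i, ‖![v, u a * v, u b * v] i‖ = ‖v‖ * ‖u a * v‖ * ‖u b * v‖ := by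
            simp [Fin.prod_univ_three]
        _ ≤ B * (E * B) * (E * B) := by gcongr; exacts [hmul a hvB, hmul b hvB]
        _ = E ^ 2 * B ^ (3 + 0) := by ring
  | succ k ih =>
    obtain ⟨w, hw, hvw, hwL, hwE, s, hs, hprod⟩ := ih (by lia)
    have : ∃ a, ∃ i, u a * w i ∉ Submodule.span ℝ (Set.range w) := by
      by_contra! h
      have htop := eq_top_of_invariant hsep (W := Submodule.span ℝ (Set.range w))
        (fun a y hy => ?_) hvw hv0
      · have := finrank_span_eq_card hw
        rw [htop, finrank_top, Module.finrank_fin_fun, Fintype.card_fin] at this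
        lia
      · have hle : Submodule.span ℝ (Set.range w) ≤
            (Submodule.span ℝ (Set.range w)).comap (LinearMap.mulLeft ℝ (u a)) := by
          rw [Submodule.span_le]
          rintro _ ⟨i, rfl⟩
          exact h a i
        exact hle hy
    obtain ⟨a, i, hai⟩ := this
    have hnorm : ‖u a * w i‖ ≤ E ^ (1 + (k + 1)) * B := by
      refine (hmul a (hwE i)).trans_eq (by ring)
    refine ⟨Fin.snoc w (u a * w i), linearIndependent_finSnoc.2 ⟨hw, hai⟩,
      Submodule.span_mono ?_ hvw, fun j => ?_, fun j => ?_, s + (k + 2), by lia, ?_⟩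
    · rintro _ ⟨j, rfl⟩
      exact ⟨Fin.castSucc j, by simp⟩
    · refine Fin.lastCases ?_ (fun j => ?_) j
      · simpa using hL a _ (hwL i)
      · simpa using hwL j
    · refine Fin.lastCases ?_ (fun j => ?_) j
      · simpa using hnorm
      · simp only [Fin.snoc_castSucc]
        refine (hwE j).trans ?_
        gcongr
        exact k.le_succ
    · have := Fin.prod_univ_castSucc (fun j => ‖(Fin.snoc w (u a * w i) : Fin (3 + k + 1) → _) j‖)
      refine this.trans_le ?_
      simp only [Fin.snoc_castSucc, Fin.snoc_last]
      calc (∏ i, ‖w i‖) * ‖u a * w i‖ ≤ (E ^ s * B ^ (3 + k)) * (E ^ (1 + (k + 1)) * B) := by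
            gcongr
        _ = _ := by ring

theorem coord_ne_zero {d : ℕ} {x : XSpace d} {ι : Type*} [Fintype ι] {t : ι → Fin d → ℝ}
    (ht : ∀ a, t a ∈ DeltaX d x) (hspan : Submodule.span ℝ (Set.range t) = V0sub d)
    {v : Fin d → ℝ} (hv : v ∈ latticeOf d x) (hv0 : v ≠ 0) (j : Fin d) : v j ≠ 0 := by
  intro hj
  obtain ⟨r, hr, hmin⟩ := exists_pos_le_norm x
  have hmem : -bstar d j ∈ V0sub d := by
    simpa [V0sub, LinearMap.sum_apply] using sum_bstar j
  obtain ⟨c, hc⟩ := (Submodule.mem_span_range_iff_exists_fun ℝ).1 (hspan.symm ▸ hmem)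
  obtain ⟨N, hN⟩ := exists_nat_gt (∑ a, ‖t a‖ - Real.log (r / ‖v‖))
  have hvpos : 0 < ‖v‖ := norm_pos_iff.2 hv0
  set z : Fin d → ℝ := ∑ a, ⌊N * c a⌋ • t a
  have hz : z ∈ DeltaX d x := sum_mem fun a _ => zsmul_mem (ht a) _
  have hzi (i : Fin d) (hij : i ≠ j) : z i < Real.log (r / ‖v‖) := by
    have h1 : ∑ a, (N * c a) * t a i = - N := by
      have := congrFun hc i
      simp only [Finset.sum_apply, Pi.smul_apply, smul_eq_mul, Pi.neg_apply, bstar, if_neg hij]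
        at this
      simp only [mul_assoc, ← Finset.mul_sum, this]
      ring
    have h2 : z i = ∑ a, (⌊N * c a⌋ : ℝ) * t a i := by
      simp [z, Finset.sum_apply]
    have h3 : z i + N ≤ ∑ a, ‖t a‖ := by
      have : z i + N = ∑ a, ((⌊N * c a⌋ : ℝ) - N * c a) * t a i := by
        simp only [sub_mul, Finset.sum_sub_distrib, h1, h2]; ring
      rw [this]
      refine Finset.sum_le_sum fun a _ => (le_abs_self _).trans ?_
      rw [abs_mul]
      refine (mul_le_of_le_one_left (abs_nonneg _) ?_).trans (norm_le_pi_norm (t a) i)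
      rw [abs_le]
      constructor <;> linarith [Int.floor_le (N * c a), Int.lt_floor_add_one (N * c a)]
    linarith
  obtain ⟨u, hu, hL⟩ := exists_multiplier hz
  have hu0 (i) : u i ≠ 0 := by
    intro h; have := hu i; rw [h, abs_zero] at this; exact (Real.exp_pos _).ne this
  have hne : u * v ≠ 0 := by
    obtain ⟨i, hi⟩ := Function.ne_iff.1 hv0
    exact Function.ne_iff.2 ⟨i, mul_ne_zero (hu0 i) hi⟩
  refine (hmin _ (hL v hv) hne).not_gt ((pi_norm_lt_iff hr).2 fun i => ?_)
  by_cases hij : i = j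
  · simp [hij, hj, hr]
  · rw [Pi.mul_apply, norm_mul, Real.norm_eq_abs (u i), hu]
    calc Real.exp (z i) * ‖v i‖ ≤ Real.exp (z i) * ‖v‖ := by gcongr; exact norm_le_pi_norm v i
      _ < r / ‖v‖ * ‖v‖ := by
        gcongr
        exact (Real.lt_log_iff_exp_lt (div_pos hr hvpos)).1 (hzi i hij)
      _ = r := div_mul_cancel₀ _ hvpos.ne'

theorem abs_det_vandermonde_le {d : ℕ} {y : Fin d → ℝ} (hy : ∀ i, |y i| ≤ 1) {j k : Fin d}
    (hjk : j ≠ k) : |(Matrix.vandermonde y).det| ≤ 2 ^ (d * d) * |y j - y k| := by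
  wlog h : j < k generalizing j k
  · rw [abs_sub_comm]
    exact this hjk.symm (lt_of_le_of_ne (not_lt.1 h) hjk.symm)
  have hpair (i l : Fin d) : |y l - y i| ≤ 2 := by
    refine (abs_sub _ _).trans ?_
    linarith [hy i, hy l]
  rw [Matrix.det_vandermonde, Finset.prod_sigma', Finset.abs_prod]
  set S := Finset.univ.sigma fun i : Fin d => Finset.Ioi i
  have hmem : (⟨j, k⟩ : Σ _ : Fin d, Fin d) ∈ S := by simp [S, h]
  rw [← Finset.mul_prod_erase S _ hmem, mul_comm, abs_sub_comm (y k)]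
  have hcard : (S.erase ⟨j, k⟩).card ≤ d * d :=
    (Finset.card_le_univ _).trans (by simp)
  gcongr
  calc ∏ p ∈ S.erase ⟨j, k⟩, |y p.2 - y p.1| ≤ ∏ p ∈ S.erase ⟨j, k⟩, (2 : ℝ) :=
        Finset.prod_le_prod (fun _ _ => abs_nonneg _) fun p _ => hpair p.1 p.2
    _ = 2 ^ (S.erase ⟨j, k⟩).card := by simp
    _ ≤ 2 ^ (d * d) := pow_le_pow_right₀ one_le_two hcard

theorem exp_le_mul_abs_sub {d : ℕ} {x : XSpace d} {u v : Fin d → ℝ}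
    (hL : ∀ w ∈ latticeOf d x, u * w ∈ latticeOf d x) (hv : v ∈ latticeOf d x)
    (hv0 : ∀ i, v i ≠ 0) (hinj : ∀ j k, j ≠ k → u j ≠ u k) {ξ N : ℝ}
    (hu : ∀ i, |u i| ≤ Real.exp ξ) (hvN : ‖v‖ ≤ N * Real.exp (-((d - 1 : ℝ) / 2) * ξ))
    {j k : Fin d} (hjk : j ≠ k) : Real.exp ξ ≤ N ^ d * 2 ^ (d * d) * |u j - u k| := by
  set y : Fin d → ℝ := fun i => Real.exp (-ξ) * u i
  have hpow (k : ℕ) : u ^ k * v ∈ latticeOf d x := by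
    induction k with
    | zero => simpa using hv
    | succ k ih => rw [pow_succ', mul_assoc]; exact hL _ ih
  have hmat : (Matrix.of fun k : Fin d => u ^ (k : ℕ) * v) =
      Matrix.of fun k i : Fin d => Real.exp ξ ^ (k : ℕ) *
        (Matrix.of fun k i : Fin d => v i * (Matrix.vandermonde y).transpose k i) k i := by
    ext k i
    have : u i = Real.exp ξ * y i := by simp [y, ← mul_assoc, ← Real.exp_add]
    simp only [Matrix.of_apply, Matrix.transpose_apply, Matrix.vandermonde_apply, Pi.mul_apply,
      Pi.pow_apply, this]
    ring
  have hdet : (Matrix.of fun k : Fin d => u ^ (k : ℕ) * v).det =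
      (∏ k : Fin d, Real.exp ξ ^ (k : ℕ)) * ((∏ i, v i) * (Matrix.vandermonde y).det) := by
    rw [hmat, Matrix.det_mul_column, Matrix.det_mul_row, Matrix.det_transpose]
  have hyinj : (Matrix.vandermonde y).det ≠ 0 := by
    rw [Ne, Matrix.det_vandermonde_eq_zero_iff]
    rintro ⟨i, l, h, hil⟩
    exact hinj i l hil (mul_left_cancel₀ (Real.exp_ne_zero _) h)
  have hexp : ∏ k : Fin d, Real.exp ξ ^ (k : ℕ) = Real.exp (d * (d - 1) / 2 * ξ) := by
    rw [Finset.prod_pow_eq_pow_sum, Fin.sum_univ_eq_sum_range (fun k => k), ← Real.exp_nat_mul]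
    congr 2
    have := Finset.sum_range_id_mul_two d
    rcases d with _ | d
    · simp
    · have h2 := congrArg (Nat.cast : ℕ → ℝ) this
      push_cast at h2 ⊢
      linarith
  have h1 : 1 ≤ |(Matrix.of fun k : Fin d => u ^ (k : ℕ) * v).det| := by
    refine one_le_abs_det (fun i => hpow i) ?_
    rw [hdet]
    exact mul_ne_zero (Finset.prod_ne_zero_iff.2 fun _ _ => pow_ne_zero _ (Real.exp_ne_zero _))
      (mul_ne_zero (Finset.prod_ne_zero_iff.2 fun i _ => hv0 i) hyinj)
  have hy1 (i) : |y i| ≤ 1 := by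
    rw [abs_mul, Real.abs_exp, Real.exp_neg, inv_mul_le_iff₀ (Real.exp_pos _), mul_one]
    exact hu i
  have hprodv : |∏ i, v i| ≤ N ^ d * Real.exp (-(d * (d - 1) / 2 * ξ)) := by
    rw [Finset.abs_prod]
    calc ∏ i, |v i| ≤ ∏ _i : Fin d, N * Real.exp (-((d - 1 : ℝ) / 2) * ξ) :=
          Finset.prod_le_prod (fun _ _ => abs_nonneg _) fun i _ =>
            (norm_le_pi_norm v i).trans hvN
      _ = _ := by
        rw [Finset.prod_const, Finset.card_univ, Fintype.card_fin, mul_pow, ← Real.exp_nat_mul]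
        congr 2
        ring
  rw [hdet, hexp, abs_mul, abs_mul, Real.abs_exp] at h1
  have hjk' : |y j - y k| = Real.exp (-ξ) * |u j - u k| := by
    simp only [y, ← mul_sub, abs_mul, Real.abs_exp]
  have h2 : 1 ≤ N ^ d * 2 ^ (d * d) * |y j - y k| := by
    calc 1 ≤ _ := h1
      _ ≤ Real.exp (d * (d - 1) / 2 * ξ) * ((N ^ d * Real.exp (-(d * (d - 1) / 2 * ξ))) *
          (2 ^ (d * d) * |y j - y k|)) := by
        gcongr
        · exact (abs_nonneg _).trans hprodv
        · exact abs_det_vandermonde_le hy1 hjk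
      _ = (Real.exp (d * (d - 1) / 2 * ξ) * Real.exp (-(d * (d - 1) / 2 * ξ))) *
          (N ^ d * 2 ^ (d * d) * |y j - y k|) := by ring
      _ = _ := by rw [← Real.exp_add, add_neg_cancel, Real.exp_zero, one_mul]
  rw [hjk', Real.exp_neg] at h2
  calc Real.exp ξ ≤ Real.exp ξ * (N ^ d * 2 ^ (d * d) * ((Real.exp ξ)⁻¹ * |u j - u k|)) :=
        le_mul_of_one_le_right (Real.exp_pos _).le h2
    _ = Real.exp ξ * (Real.exp ξ)⁻¹ * (N ^ d * 2 ^ (d * d) * |u j - u k|) := by ring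
    _ = _ := by rw [mul_inv_cancel₀ (Real.exp_ne_zero _), one_mul]

/-- A zero-sum vector whose exponentials are all separated at scale `e^ξ` lies at bounded distance
from a multiple of a standard simplex vector. -/
theorem exists_near_bstar {d : ℕ} (hd : 2 ≤ d) {u t : Fin d → ℝ} {ξ A : ℝ} (hA : 0 < A)
    (hut : ∀ i, |u i| = Real.exp (t i)) (ht0 : ∑ i, t i = 0) (htξ : ∀ i, t i ≤ ξ)
    (hsep : ∀ j k, j ≠ k → Real.exp ξ ≤ A * |u j - u k|) :
    ∃ m, (∀ j, j ≠ m → ξ - Real.log (2 * A) ≤ t j) ∧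
      ∀ j, |t j - ξ * bstar d m j| ≤ d * |Real.log (2 * A)| := by
  have : Nonempty (Fin d) := ⟨⟨0, by lia⟩⟩
  obtain ⟨m, hm⟩ := Finite.exists_min t
  set C := Real.log (2 * A)
  have hC : C ≤ |C| := le_abs_self C
  have hd' : (2 : ℝ) ≤ d := by exact_mod_cast hd
  have hlow (j) (hj : j ≠ m) : ξ - C ≤ t j := by
    have h1 := hsep j m hj
    have h2 : |u j - u m| ≤ 2 * Real.exp (t j) := by
      refine (abs_sub _ _).trans ?_
      rw [hut, hut]
      linarith [Real.exp_le_exp.2 (hm j)]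
    rw [← Real.exp_le_exp, Real.exp_sub, Real.exp_log (by positivity),
      div_le_iff₀ (by positivity)]
    nlinarith
  refine ⟨m, hlow, fun j => ?_⟩
  by_cases hj : j = m
  · subst hj
    have h1 : t j - ξ * bstar d j j = ∑ i ∈ Finset.univ.erase j, (ξ - t i) := by
      rw [← Finset.add_sum_erase _ _ (Finset.mem_univ j)] at ht0
      rw [Finset.sum_sub_distrib, Finset.sum_const, Finset.card_erase_of_mem (Finset.mem_univ j),
        Finset.card_univ, Fintype.card_fin, nsmul_eq_mul, Nat.cast_sub (by lia)]
      simp only [bstar, if_true, Nat.cast_one]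
      linarith
    rw [h1]
    refine (Finset.abs_sum_le_sum_abs _ _).trans ?_
    calc ∑ i ∈ Finset.univ.erase j, |ξ - t i| ≤ ∑ i ∈ Finset.univ.erase j, |C| := by
          refine Finset.sum_le_sum fun i hi => ?_
          rw [abs_of_nonneg (by linarith [htξ i])]
          linarith [hlow i (Finset.ne_of_mem_erase hi)]
      _ ≤ ∑ i : Fin d, |C| := Finset.sum_le_sum_of_subset_of_nonneg (Finset.erase_subset _ _)
          fun _ _ _ => abs_nonneg _
      _ = d * |C| := by simp
  · have : bstar d m j = 1 := if_neg hj
    rw [this, mul_one, abs_sub_comm, abs_of_nonneg (by linarith [htξ j])]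
    nlinarith [hlow j hj, abs_nonneg C]

/-- If the nonzero members of a zero-sum family of distinct vectors are positive off a single
coordinate, these coordinates are a permutation of the index set. -/
theorem exists_bijective_of_pos_off {d : ℕ} (hd : 2 ≤ d) {t : Fin d → Fin d → ℝ}
    (hinj : Function.Injective t) (hsum : ∑ i, t i = 0) {Q : Fin d → Fin d → Prop}
    (h : ∀ i, t i ≠ 0 → ∃ m, (∀ j, j ≠ m → 0 < t i j) ∧ Q i m) :
    (∀ i, t i ≠ 0) ∧ ∃ σ : Fin d → Fin d, Function.Injective σ ∧ ∀ i, Q i (σ i) := by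
  have : Nonempty (Fin d) := ⟨⟨0, by lia⟩⟩
  choose! σ hσ hQ using h
  have hsurj (j : Fin d) : ∃ i, t i ≠ 0 ∧ σ i = j := by
    by_contra! hcon
    obtain ⟨i, hi⟩ : ∃ i, t i ≠ 0 := by
      by_contra! h0
      have : (⟨0, by lia⟩ : Fin d) = ⟨1, by lia⟩ := hinj ((h0 _).trans (h0 _).symm)
      simp at this
    have hnonneg (l) : 0 ≤ t l j := by
      by_cases hl : t l = 0
      · simp [hl]
      · exact (hσ l hl j (hcon l hl).symm).le
    have h0 : ∑ l, t l j = 0 := by simpa using congrFun hsum j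
    have := (Finset.sum_eq_zero_iff_of_nonneg fun l _ => hnonneg l).1 h0 i (Finset.mem_univ i)
    exact (hσ i hi j (hcon i hi).symm).ne' this
  choose ρ hρ0 hρ using hsurj
  have hρinj : Function.Injective ρ := fun a b hab => by rw [← hρ a, ← hρ b, hab]
  have hρsurj := Finite.injective_iff_surjective.1 hρinj
  have hne (i) : t i ≠ 0 := by
    obtain ⟨j, rfl⟩ := hρsurj i
    exact hρ0 j
  have hσsurj : Function.Surjective σ := fun j => ⟨ρ j, hρ j⟩
  exact ⟨hne, σ, Finite.injective_iff_surjective.2 hσsurj, fun i => hQ i (hne i)⟩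

/-- The Gram matrix of a tuple of vectors. -/
def gramMatrix (d : ℕ) (v : Fin (d - 1) → Fin d → ℝ) : Matrix (Fin (d - 1)) (Fin (d - 1)) ℝ :=
  Matrix.of v * (Matrix.of v).transpose

theorem gram_eq {d : ℕ} (v : Fin (d - 1) → Fin d → ℝ) :
    gram d v = Real.sqrt |(gramMatrix d v).det| := by
  rw [gram, gramMatrix]
  congr 3

theorem continuous_gram (d : ℕ) : Continuous (gram d) := by
  rw [funext fun v => gram_eq (d := d) v]
  unfold gramMatrix
  have : Continuous fun v : Fin (d - 1) → Fin d → ℝ => Matrix.of v := continuous_id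
  exact ((this.matrix_mul this.matrix_transpose).matrix_det.abs).sqrt

theorem gram_smul {d : ℕ} {c : ℝ} (hc : 0 ≤ c) (v : Fin (d - 1) → Fin d → ℝ) :
    gram d (c • v) = c ^ (d - 1) * gram d v := by
  have : gramMatrix d (c • v) = (c ^ 2) • gramMatrix d v := by
    unfold gramMatrix
    have : Matrix.of (c • v) = c • Matrix.of v := rfl
    rw [this, Matrix.transpose_smul, Matrix.smul_mul, Matrix.mul_smul, smul_smul, sq]
  rw [gram_eq, gram_eq, this, Matrix.det_smul, abs_mul, Real.sqrt_mul (abs_nonneg _),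
    Fintype.card_fin, ← pow_mul, mul_comm 2, pow_mul, abs_of_nonneg (sq_nonneg _),
    Real.sqrt_sq (pow_nonneg hc _)]

theorem gram_int_combination {d : ℕ} (G : Matrix (Fin (d - 1)) (Fin (d - 1)) ℤ)
    (v : Fin (d - 1) → Fin d → ℝ) :
    gram d (fun i => ∑ j, (G i j : ℝ) • v j) = |(G.det : ℝ)| * gram d v := by
  have h : Matrix.of (fun i => ∑ j, (G i j : ℝ) • v j) =
      G.map (Int.cast : ℤ → ℝ) * Matrix.of v := by
    ext i k
    simp [Matrix.mul_apply, Finset.sum_apply]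
  have hG : (G.map (Int.cast : ℤ → ℝ)).det = G.det := (Int.cast_det G).symm
  have : gramMatrix d (fun i => ∑ j, (G i j : ℝ) • v j) =
      G.map (Int.cast : ℤ → ℝ) * gramMatrix d v * (G.map (Int.cast : ℤ → ℝ)).transpose := by
    unfold gramMatrix
    rw [h, Matrix.transpose_mul]
    simp only [Matrix.mul_assoc]
  rw [gram_eq, gram_eq, this, Matrix.det_mul, Matrix.det_mul, Matrix.det_transpose, hG,
    mul_comm, ← mul_assoc, abs_mul, Real.sqrt_mul (abs_nonneg _), abs_mul, ← sq,
    Real.sqrt_sq (abs_nonneg _)]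

theorem exists_int_combination {d : ℕ} {v w : Fin (d - 1) → Fin d → ℝ}
    (h : AddSubgroup.closure (Set.range w) ≤ AddSubgroup.closure (Set.range v)) :
    ∃ G : Matrix (Fin (d - 1)) (Fin (d - 1)) ℤ, w = fun i => ∑ j, (G i j : ℝ) • v j := by
  have hmem (i) : ∃ c : Fin (d - 1) → ℤ, ∑ j, c j • v j = w i := by
    have hi := h (AddSubgroup.subset_closure (Set.mem_range_self i))
    rw [← Submodule.span_int_eq_addSubgroupClosure, Submodule.mem_toAddSubgroup] at hi
    exact (Submodule.mem_span_range_iff_exists_fun ℤ).1 hi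
  choose G hG using hmem
  refine ⟨G, funext fun i => ?_⟩
  rw [← hG i]
  exact Finset.sum_congr rfl fun j _ => (Int.cast_smul_eq_zsmul ℝ _ _).symm

theorem gram_eq_of_closure_eq {d : ℕ} {v w : Fin (d - 1) → Fin d → ℝ}
    (h : AddSubgroup.closure (Set.range v) = AddSubgroup.closure (Set.range w))
    (hw : 0 < gram d w) : gram d v = gram d w := by
  obtain ⟨G, hG⟩ := exists_int_combination h.ge
  obtain ⟨H, hH⟩ := exists_int_combination h.le
  have h1 : gram d w = |(G.det : ℝ)| * gram d v := by
    conv_lhs => rw [hG]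
    exact gram_int_combination G v
  have h2 : gram d v = |(H.det : ℝ)| * gram d w := by
    conv_lhs => rw [hH]
    exact gram_int_combination H w
  have h3 : |(G.det : ℝ)| * |(H.det : ℝ)| = 1 := by
    rw [h2] at h1
    have := mul_right_cancel₀ hw.ne' ((mul_assoc _ _ _).trans (h1.symm.trans (one_mul _).symm))
    exact this
  have h4 : |H.det| = 1 := by
    have : |G.det| * |H.det| = 1 := by exact_mod_cast h3
    exact Int.eq_one_of_mul_eq_one_left (abs_nonneg _) this
  rw [h2, ← Int.cast_abs, h4, Int.cast_one, one_mul]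

theorem gram_bstar_pos {d : ℕ} (hd : 2 ≤ d) {τ : Fin (d - 1) → Fin d}
    (hτ : Function.Injective τ) : 0 < gram d fun i => bstar d (τ i) := by
  rw [gram_eq]
  refine Real.sqrt_pos.2 (abs_pos.2 (det_ne_zero_of_sum_row_lt_diag fun k => ?_))
  have hd' : (2 : ℝ) ≤ d := by exact_mod_cast hd
  have hentry (i j) : gramMatrix d (fun i => bstar d (τ i)) i j =
      if i = j then (d : ℝ) * (d - 1) else -d := by
    have h0 : gramMatrix d (fun i => bstar d (τ i)) i j =
        ∑ k, bstar d (τ i) k * bstar d (τ j) k := by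
      simp [gramMatrix, Matrix.mul_apply]
    have h1 : ∑ k, bstar d (τ i) k * bstar d (τ j) k = -(d * bstar d (τ i) (τ j)) := by
      have (k : Fin d) : bstar d (τ i) k * bstar d (τ j) k =
          bstar d (τ i) k - if k = τ j then d * bstar d (τ i) (τ j) else 0 := by
        simp only [bstar_eq (τ j), Pi.sub_apply, Pi.one_apply, Pi.single_apply]
        split_ifs with h
        · subst h; ring
        · ring
      simp only [this, Finset.sum_sub_distrib, sum_bstar]
      simp
    rw [h0, h1]
    by_cases hij : i = j
    · subst hij; simp [bstar]; ring
    · simp [bstar, hij, (hτ.ne hij).symm]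
  have hoff : ∑ j ∈ Finset.univ.erase k, ‖gramMatrix d (fun i => bstar d (τ i)) k j‖ =
      (d - 2) * d := by
    rw [Finset.sum_congr rfl fun j hj => by
      rw [hentry, if_neg (Finset.ne_of_mem_erase hj).symm, norm_neg, Real.norm_natCast]]
    rw [Finset.sum_const, Finset.card_erase_of_mem (Finset.mem_univ k), Finset.card_univ,
      Fintype.card_fin, nsmul_eq_mul, Nat.sub_sub, Nat.cast_sub hd]
    norm_num
  rw [hoff, hentry, if_pos rfl, Real.norm_of_nonneg (by nlinarith)]
  nlinarith

theorem exists_gram_lower_bound {d : ℕ} (hd : 2 ≤ d) :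
    ∃ δ > 0, ∃ κ > 0, ∀ (τ : Fin (d - 1) → Fin d), Function.Injective τ →
      ∀ w : Fin (d - 1) → Fin d → ℝ, (∀ i, ‖w i - bstar d (τ i)‖ < δ) → κ ≤ gram d w := by
  have h (τ : Fin (d - 1) → Fin d) : ∀ᶠ δ : ℝ in nhdsWithin 0 (Set.Ioi 0), Function.Injective τ →
      ∀ w : Fin (d - 1) → Fin d → ℝ, (∀ i, ‖w i - bstar d (τ i)‖ < δ) → δ ≤ gram d w := by
    by_cases hτ : Function.Injective τ
    · have hpos := gram_bstar_pos hd hτ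
      obtain ⟨ε, hε, hball⟩ := Metric.eventually_nhds_iff.1
        ((continuous_gram d).continuousAt.eventually (lt_mem_nhds (half_lt_self hpos)))
      filter_upwards [Ioo_mem_nhdsGT (lt_min hε (half_pos hpos))] with δ hδ _ w hw
      refine (hδ.2.le.trans (min_le_right _ _)).trans (hball ?_).le
      rw [dist_eq_norm, pi_norm_lt_iff hε]
      exact fun i => (hw i).trans (hδ.2.trans_le (min_le_left _ _))
    · exact Filter.Eventually.of_forall fun _ h => absurd h hτ
  obtain ⟨δ, hδ, hpos⟩ := ((Filter.eventually_all.2 h).and self_mem_nhdsWithin).exists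
  exact ⟨δ, hpos, δ, hpos, hδ⟩

theorem closure_range_initial {d : ℕ} (hd : 2 ≤ d) {t : Fin d → Fin d → ℝ}
    (hsum : ∑ i, t i = 0) :
    AddSubgroup.closure (Set.range fun i : Fin (d - 1) => t (Fin.castLE (Nat.sub_le d 1) i)) =
      AddSubgroup.closure (Set.range t) := by
  obtain ⟨n, rfl⟩ : ∃ n, d = n + 1 := ⟨d - 1, by lia⟩
  refine le_antisymm (AddSubgroup.closure_mono ?_) ((AddSubgroup.closure_le _).2 ?_)
  · rintro _ ⟨i, rfl⟩
    exact ⟨_, rfl⟩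
  · rintro _ ⟨i, rfl⟩
    have hinit (i : Fin n) : t i.castSucc ∈ AddSubgroup.closure
        (Set.range fun i : Fin (n + 1 - 1) => t (Fin.castLE (Nat.sub_le (n + 1) 1) i)) :=
      AddSubgroup.subset_closure ⟨i, rfl⟩
    refine Fin.lastCases ?_ hinit i
    rw [Fin.sum_univ_castSucc] at hsum
    rw [eq_neg_of_add_eq_zero_right hsum]
    exact neg_mem (sum_mem fun i _ => hinit i)

theorem covolSS_eq_gram {d : ℕ} (hd : 2 ≤ d) (Φ : SimplexSet d) {t : Fin d → Fin d → ℝ}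
    (hrange : Set.range t = Φ.elems) (hsum : ∑ i, t i = 0)
    (hpos : 0 < gram d fun i => t (Fin.castLE (Nat.sub_le d 1) i)) :
    covolSS Φ = gram d fun i => t (Fin.castLE (Nat.sub_le d 1) i) := by
  rw [covolSS, covolSet, ← hrange, ← closure_range_initial hd hsum]
  have : {r | ∃ v : Fin (d - 1) → Fin d → ℝ, AddSubgroup.closure (Set.range v) =
      AddSubgroup.closure (Set.range fun i : Fin (d - 1) => t (Fin.castLE (Nat.sub_le d 1) i)) ∧
      r = gram d v} = {gram d fun i => t (Fin.castLE (Nat.sub_le d 1) i)} := by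
    ext r
    constructor
    · rintro ⟨v, hv, rfl⟩
      exact gram_eq_of_closure_eq hv hpos
    · rintro rfl
      exact ⟨_, rfl, rfl⟩
  rw [this, csInf_singleton]

theorem exists_enumeration {d : ℕ} (Φ : SimplexSet d) :
    ∃ t : Fin d → Fin d → ℝ, Function.Injective t ∧ Set.range t = Φ.elems ∧ ∑ i, t i = 0 := by
  have hb : Function.Bijective fun i => Φ.elems.equivFin.symm (finCongr Φ.card_eq.symm i) :=
    (((finCongr Φ.card_eq.symm).trans Φ.elems.equivFin.symm)).bijective
  have hrange : Set.range (ssEnum Φ) = Φ.elems := by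
    ext y
    constructor
    · rintro ⟨i, rfl⟩
      exact Subtype.coe_prop _
    · intro hy
      obtain ⟨i, hi⟩ := hb.2 ⟨y, hy⟩
      exact ⟨i, congrArg Subtype.val hi⟩
  refine ⟨ssEnum Φ, Subtype.val_injective.comp hb.1, hrange, ?_⟩
  rw [← Φ.sum_eq_zero, ← Finset.sum_coe_sort Φ.elems]
  exact Fintype.sum_bijective _ hb _ _ fun _ => rfl

theorem coord_le_xi {d : ℕ} {Φ : SimplexSet d} {t : Fin d → ℝ} (ht : t ∈ Φ.elems) (i : Fin d) :
    t i ≤ xi Φ :=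
  (le_ciSup (Set.finite_range t).bddAbove i).trans
    (le_csSup (Φ.elems.finite_toSet.image _).bddAbove (Set.mem_image_of_mem _ ht))

theorem sum_eq_zero_of_mem {d : ℕ} {Φ : SimplexSet d} {t : Fin d → ℝ} (ht : t ∈ Φ.elems) :
    ∑ i, t i = 0 := by
  have : t ∈ V0sub d := Φ.span_eq ▸ Submodule.subset_span ht
  simpa [V0sub, LinearMap.sum_apply] using this

theorem norm_le_of_coord_le {d : ℕ} (hd : 2 ≤ d) {t : Fin d → ℝ} (h0 : ∑ i, t i = 0) {ξ : ℝ}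
    (h : ∀ i, t i ≤ ξ) : ‖t‖ ≤ d * ξ := by
  have hd' : (2 : ℝ) ≤ d := by exact_mod_cast hd
  have hξ : 0 ≤ ξ := by
    have : ∑ i, t i ≤ d * ξ := by
      simpa using Finset.sum_le_sum (s := Finset.univ) fun i _ => h i
    rw [h0] at this
    exact nonneg_of_mul_nonneg_right this (by linarith)
  refine (pi_norm_le_iff_of_nonneg (by positivity)).2 fun i => abs_le.2 ⟨?_, ?_⟩
  · rw [← Finset.add_sum_erase _ _ (Finset.mem_univ i)] at h0
    have h1 : ∑ j ∈ Finset.univ.erase i, t j ≤ (d - 1) * ξ := by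
      refine (Finset.sum_le_sum fun j _ => h j).trans_eq ?_
      rw [Finset.sum_const, Finset.card_erase_of_mem (Finset.mem_univ i), Finset.card_univ,
        Fintype.card_fin, nsmul_eq_mul, Nat.cast_sub (by lia), Nat.cast_one]
    linarith
  · nlinarith [h i]

theorem normOnV0_le {d : ℕ} (hd : 2 ≤ d) {Φ : SimplexSet d}
    {h : (Fin d → ℝ) →ₗ[ℝ] (Fin d → ℝ)} (hh : IsDistortion Φ h) {T : ℝ}
    (hT : ∀ t ∈ Φ.elems, ‖covolSS Φ ^ (-(1 : ℝ) / (d - 1 : ℝ)) • t‖ ≤ T) :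
    normOnV0 d h ≤ T := by
  have hb (j) : ‖h (bstar d j)‖ ≤ T := by
    have : h (bstar d j) ∈ h '' Set.range (bstar d) := ⟨_, ⟨j, rfl⟩, rfl⟩
    rw [hh] at this
    obtain ⟨t, ht, h1⟩ := this
    rw [← h1]
    exact hT t ht
  have hd' : (2 : ℝ) ≤ d := by exact_mod_cast hd
  have hT0 : 0 ≤ T := (norm_nonneg _).trans (hb ⟨0, by lia⟩)
  refine csSup_le ⟨_, 0, by simp, by simp, rfl⟩ ?_
  rintro _ ⟨v, hv0, hv1, rfl⟩
  have hv : v = ∑ j, (-(v j / d)) • bstar d j := by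
    ext i
    have h2 (j) : (-(v j / d)) * bstar d j i = -(v j) / d + if i = j then v i else 0 := by
      rw [bstar_eq, Pi.sub_apply, Pi.one_apply, Pi.single_apply]
      split_ifs with hij
      · subst hij; field_simp; ring
      · ring
    simp only [Finset.sum_apply, Pi.smul_apply, smul_eq_mul, h2, Finset.sum_add_distrib,
      ← Finset.sum_div, Finset.sum_neg_distrib, hv0]
    simp
  conv_lhs => rw [hv, map_sum]
  calc ‖∑ j, h ((-(v j / d)) • bstar d j)‖ ≤ ∑ _j : Fin d, (d : ℝ)⁻¹ * T := by
        refine norm_sum_le_of_le _ fun j _ => ?_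
        rw [map_smul, norm_smul, norm_neg, norm_div, Real.norm_natCast, div_eq_inv_mul]
        have h3 : ‖v j‖ ≤ 1 := (norm_le_pi_norm v j).trans hv1
        have := hb j
        gcongr
        exact mul_le_of_le_one_right (by positivity) h3
    _ = T := by
      rw [Finset.sum_const, Finset.card_univ, Fintype.card_fin, nsmul_eq_mul, ← mul_assoc,
        mul_inv_cancel₀ (by linarith), one_mul]

theorem not_linearIndependent_of_short {d : ℕ} {x : XSpace d} {ι : Type*} [Nonempty ι]
    {u : ι → Fin d → ℝ} (hL : ∀ a, ∀ w ∈ latticeOf d x, u a * w ∈ latticeOf d x)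
    (hsep : ∀ j k, j ≠ k → ∃ a, u a j ≠ u a k) {ξ N : ℝ} (hN : 0 < N) (hξ0 : 0 ≤ ξ)
    (hu : ∀ a i, |u a i| ≤ Real.exp ξ) (hξ : d.factorial * N ^ d < Real.exp ξ)
    {v : Fin d → ℝ} (hv : v ∈ latticeOf d x) (hv0 : ∀ i, v i ≠ 0)
    (hvN : ‖v‖ ≤ N * Real.exp (-((d - 1 : ℝ) / 2) * ξ)) (a b : ι) :
    ¬ LinearIndependent ℝ ![v, u a * v, u b * v] := by
  intro hab
  have h3 : 3 ≤ d := by simpa using hab.fintype_card_le_finrank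
  obtain ⟨k, rfl⟩ := Nat.exists_eq_add_of_le h3
  obtain ⟨w, hw, -, hwL, -, s, hs, hprod⟩ := exists_linearIndependent_chain hsep hL
    (Real.one_le_exp hξ0) (fun a => (pi_norm_le_iff_of_nonneg (Real.exp_pos ξ).le).2 (hu a))
    hv hv0 hvN hab k le_rfl
  have hdet : (Matrix.of w).det ≠ 0 :=
    ((Matrix.isUnit_iff_isUnit_det _).1 (Matrix.linearIndependent_rows_iff_isUnit.1 hw)).ne_zero
  have hone := (one_le_abs_det hwL hdet).trans (abs_det_le w)
  have hs' : (2 : ℝ) * s = 4 + k * (k + 3) := by exact_mod_cast hs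
  have hexp : Real.exp ξ ^ s * (N * Real.exp (-(((3 + k : ℕ) - 1 : ℝ) / 2) * ξ)) ^ (3 + k) =
      N ^ (3 + k) * Real.exp (-((k + 1) * ξ)) := by
    rw [mul_pow, ← Real.exp_nat_mul, ← Real.exp_nat_mul, mul_left_comm, ← Real.exp_add]
    congr 2
    push_cast
    linear_combination ξ / 2 * hs'
  have hle : Real.exp (-((k + 1) * ξ)) ≤ Real.exp (-ξ) := by
    refine Real.exp_le_exp.2 (neg_le_neg ?_)
    have : 0 ≤ (k : ℝ) * ξ := by positivity
    linarith
  have hlt : ((3 + k).factorial : ℝ) * N ^ (3 + k) * Real.exp (-ξ) < 1 := by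
    rw [Real.exp_neg, ← div_eq_mul_inv]
    exact (div_lt_one (Real.exp_pos ξ)).2 hξ
  refine absurd hone (not_le.2 (lt_of_le_of_lt ?_ hlt))
  rw [mul_assoc]
  refine mul_le_mul_of_nonneg_left (hprod.trans ?_) (by positivity)
  rw [hexp]
  gcongr

theorem coord_ne_of_not_linearIndependent {d : ℕ} {ι : Type*} {u : ι → Fin d → ℝ}
    {v : Fin d → ℝ} (hdep : ∀ a b, ¬ LinearIndependent ℝ ![v, u a * v, u b * v])
    (hv0 : ∀ i, v i ≠ 0) (hsep : ∀ j k, j ≠ k → ∃ a, u a j ≠ u a k) {a : ι}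
    (ha : ∃ j k, u a j ≠ u a k) (j k : Fin d) (hjk : j ≠ k) : u a j ≠ u a k := by
  intro heq
  obtain ⟨b, hb⟩ := hsep j k hjk
  obtain ⟨g, hg, i, hi⟩ := Fintype.not_linearIndependent_iff.1 (hdep a b)
  have hl (l) : g 0 + g 1 * u a l + g 2 * u b l = 0 := by
    have := congrFun hg l
    simp only [Fin.sum_univ_three, Matrix.cons_val, Pi.add_apply, Pi.smul_apply, Pi.mul_apply,
      smul_eq_mul, Pi.zero_apply] at this
    exact mul_right_cancel₀ (hv0 l) (by linear_combination this)
  have h2 : g 2 = 0 := by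
    refine (mul_eq_zero.1 (?_ : g 2 * (u b j - u b k) = 0)).resolve_right (sub_ne_zero.2 hb)
    linear_combination hl j - hl k - g 1 * heq
  obtain ⟨p, q, hpq⟩ := ha
  have h1 : g 1 = 0 := by
    refine (mul_eq_zero.1 (?_ : g 1 * (u a p - u a q) = 0)).resolve_right (sub_ne_zero.2 hpq)
    linear_combination hl p - hl q - (u b p - u b q) * h2
  have h0 : g 0 = 0 := by simpa [h1, h2] using hl p
  fin_cases i <;> simp_all

theorem exists_bound_of_xi_large {d : ℕ} (hd : 2 ≤ d) {M : ℝ} (hM : 0 < M) :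
    ∃ ξ₀ T : ℝ, ∀ (x : XSpace d) (Φ : SimplexSet d), IsTight d M x Φ → ξ₀ ≤ xi Φ →
      ∀ t ∈ Φ.elems, ‖covolSS Φ ^ (-(1 : ℝ) / (d - 1 : ℝ)) • t‖ ≤ T := by
  obtain ⟨δ, hδ, κ, hκ, hgram⟩ := exists_gram_lower_bound hd
  have hd' : (2 : ℝ) ≤ d := by exact_mod_cast hd
  set N := 2 * M
  have hN : 0 < N := by positivity
  set A := N ^ d * 2 ^ (d * d)
  have hA : 0 < A := by positivity
  obtain ⟨ξ₀, hξ₀⟩ := Filter.eventually_atTop.1 ((Filter.eventually_gt_atTop (0 : ℝ)).and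
    ((Real.tendsto_exp_atTop.eventually_gt_atTop (d.factorial * N ^ d)).and
    ((Filter.eventually_gt_atTop (Real.log (2 * A))).and
    (Filter.eventually_gt_atTop (d * |Real.log (2 * A)| / δ)))))
  refine ⟨ξ₀, κ ^ (-(1 : ℝ) / (d - 1 : ℝ)) * d, fun x Φ hΦ hξ => ?_⟩
  obtain ⟨hpos, hexp, hlog, hclose⟩ := hξ₀ _ hξ
  set ξ := xi Φ
  obtain ⟨t, hinj, hrange, hsum⟩ := exists_enumeration Φ
  have hmem (a) : t a ∈ Φ.elems := by
    have : t a ∈ (Φ.elems : Set (Fin d → ℝ)) := hrange ▸ Set.mem_range_self a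
    exact this
  have hspan : Submodule.span ℝ (Set.range t) = V0sub d := hrange ▸ Φ.span_eq
  have hΔ (a) : t a ∈ DeltaX d x := hΦ.1 (hmem a)
  choose u hut hL using fun a => exists_multiplier (hΔ a)
  have hsep (j k) (hjk : j ≠ k) : ∃ a, u a j ≠ u a k := by
    obtain ⟨a, ha⟩ := exists_ne_coord hspan hjk
    refine ⟨a, fun h => ha (Real.exp_injective ?_)⟩
    rw [← hut, ← hut, h]
  have hu (a i) : |u a i| ≤ Real.exp ξ := by
    rw [hut]
    exact Real.exp_le_exp.2 (coord_le_xi (hmem a) i)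
  obtain ⟨v, hv, hvne, hvN⟩ := exists_short_vector (r := N * Real.exp (-((d - 1 : ℝ) / 2) * ξ)) hd
    (hΦ.2.trans_lt (mul_lt_mul_of_pos_right (by linarith : M < N) (Real.exp_pos _)))
  have hv0 := coord_ne_zero hΔ hspan hv hvne
  have : Nonempty (Fin d) := ⟨⟨0, by lia⟩⟩
  have hdep := not_linearIndependent_of_short hL hsep hN hpos.le hu hexp hv hv0 hvN.le
  have hnear (a) (ha : t a ≠ 0) : ∃ m, (∀ j, j ≠ m → 0 < t a j) ∧
      ∀ j, |t a j - ξ * bstar d m j| ≤ d * |Real.log (2 * A)| := by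
    have h0 := sum_eq_zero_of_mem (hmem a)
    have hne : ∃ j k, u a j ≠ u a k := by
      by_contra! hconst
      refine ha (funext fun j => ?_)
      have htj (k : Fin d) : t a k = t a j := Real.exp_injective (by rw [← hut, ← hut, hconst k j])
      simp only [htj, Finset.sum_const, Finset.card_univ, Fintype.card_fin, nsmul_eq_mul,
        mul_eq_zero] at h0
      exact h0.resolve_left (by linarith)
    have hdist := coord_ne_of_not_linearIndependent hdep hv0 hsep hne
    obtain ⟨m, hm, hm'⟩ := exists_near_bstar hd hA (hut a) h0 (coord_le_xi (hmem a))
      fun j k hjk => exp_le_mul_abs_sub (hL a) hv hv0 hdist (hu a) hvN.le hjk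
    exact ⟨m, fun j hj => (sub_pos.2 hlog).trans_le (hm j hj), hm'⟩
  obtain ⟨-, σ, hσ, hclose'⟩ := exists_bijective_of_pos_off hd hinj hsum hnear
  have hscale : (fun i : Fin (d - 1) => t (Fin.castLE (Nat.sub_le d 1) i)) =
      ξ • fun i : Fin (d - 1) => ξ⁻¹ • t (Fin.castLE (Nat.sub_le d 1) i) := by
    funext i
    simp [smul_smul, hpos.ne']
  have hlower : ξ ^ (d - 1) * κ ≤ gram d fun i => t (Fin.castLE (Nat.sub_le d 1) i) := by
    rw [hscale, gram_smul hpos.le]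
    gcongr
    refine hgram (fun i => σ (Fin.castLE (Nat.sub_le d 1) i))
      (hσ.comp (Fin.castLE_injective _)) _ fun i => ?_
    refine (pi_norm_lt_iff hδ).2 fun j => ?_
    have h1 := hclose' (Fin.castLE (Nat.sub_le d 1) i) j
    rw [div_lt_iff₀ hδ] at hclose
    rw [Pi.sub_apply, Pi.smul_apply, smul_eq_mul, Real.norm_eq_abs,
      ← mul_lt_mul_iff_right₀ hpos]
    refine lt_of_eq_of_lt ?_ (h1.trans_lt hclose)
    conv_lhs => rw [← abs_of_pos hpos, ← abs_mul]
    rw [abs_of_pos hpos]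
    congr 1
    field_simp
  have hcov := covolSS_eq_gram hd Φ hrange hsum
    ((by positivity : 0 < ξ ^ (d - 1) * κ).trans_le hlower)
  rw [← hcov] at hlower
  intro s hs
  have hd1 : (0 : ℝ) < d - 1 := by linarith
  have hpow : covolSS Φ ^ (-(1 : ℝ) / (d - 1 : ℝ)) ≤ κ ^ (-(1 : ℝ) / (d - 1 : ℝ)) * ξ⁻¹ := by
    refine (Real.rpow_le_rpow_of_nonpos (by positivity) hlower
      (div_nonpos_of_nonpos_of_nonneg (by norm_num) hd1.le)).trans_eq ?_
    rw [Real.mul_rpow (by positivity) hκ.le, mul_comm, ← Real.rpow_natCast, ← Real.rpow_mul hpos.le,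
      Nat.cast_sub (by lia), Nat.cast_one, mul_div_cancel₀ _ hd1.ne', Real.rpow_neg_one]
  have hcov0 : 0 ≤ covolSS Φ := (by positivity : 0 ≤ ξ ^ (d - 1) * κ).trans hlower
  rw [norm_smul, Real.norm_of_nonneg (Real.rpow_nonneg hcov0 _)]
  calc _ ≤ (κ ^ (-(1 : ℝ) / (d - 1 : ℝ)) * ξ⁻¹) * (d * ξ) := by
        gcongr
        exact norm_le_of_coord_le hd (sum_eq_zero_of_mem hs) (coord_le_xi hs)
    _ = κ ^ (-(1 : ℝ) / (d - 1 : ℝ)) * d := by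
        field_simp

theorem SimplexSet.elems_injective {d : ℕ} :
    Function.Injective (SimplexSet.elems : SimplexSet d → Finset (Fin d → ℝ)) := by
  rintro ⟨⟩ ⟨⟩ rfl
  rfl

theorem exists_bound_of_xi_le {d : ℕ} (hd : 2 ≤ d) (ξ₀ : ℝ) :
    ∃ T : ℝ, ∀ (x : XSpace d) (Φ : SimplexSet d),
      (Φ.elems : Set (Fin d → ℝ)) ⊆ (DeltaX d x : Set (Fin d → ℝ)) → xi Φ ≤ ξ₀ →
      ∀ t ∈ Φ.elems, ‖covolSS Φ ^ (-(1 : ℝ) / (d - 1 : ℝ)) • t‖ ≤ T := by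
  have hfin := finite_bounded_mem_DeltaX d (d * ξ₀)
  have hΦ : {Φ : SimplexSet d | Φ.elems ∈ hfin.toFinset.powerset}.Finite :=
    (Finset.finite_toSet _).preimage SimplexSet.elems_injective.injOn
  obtain ⟨T, hT⟩ := ((hΦ.prod hfin).image fun p : SimplexSet d × (Fin d → ℝ) =>
    ‖covolSS p.1 ^ (-(1 : ℝ) / (d - 1 : ℝ)) • p.2‖).bddAbove
  refine ⟨T, fun x Φ hx hξ => ?_⟩
  have hmem (t) (ht : t ∈ Φ.elems) :
      t ∈ {t : Fin d → ℝ | (∃ x, t ∈ DeltaX d x) ∧ ‖t‖ ≤ d * ξ₀} :=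
    ⟨⟨x, hx ht⟩, norm_le_of_coord_le hd (sum_eq_zero_of_mem ht)
      fun i => (coord_le_xi ht i).trans hξ⟩
  intro t ht
  refine hT ⟨(Φ, t), ⟨?_, hmem t ht⟩, rfl⟩
  exact Finset.mem_powerset.2 fun s hs => hfin.mem_toFinset.2 (hmem s hs)

theorem stmt18 (d : ℕ) (hd : 2 ≤ d) (M : ℝ) (hM : 0 < M)
    (K : Set (ShapeSpace d)) (hK : IsCompact K) :
    ∃ T : ℝ, 0 < T ∧ ∀ x ∈ OmegaMK d M K, ∀ Φ : SimplexSet d, IsTight d M x Φ →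
      ∀ h : (Fin d → ℝ) →ₗ[ℝ] (Fin d → ℝ), IsDistortion Φ h → normOnV0 d h ≤ T := by
  obtain ⟨ξ₀, T₁, hT₁⟩ := exists_bound_of_xi_large hd hM
  obtain ⟨T₂, hT₂⟩ := exists_bound_of_xi_le hd ξ₀
  refine ⟨max 1 (max T₁ T₂), by positivity, fun x _ Φ hΦ h hh => ?_⟩
  refine normOnV0_le hd hh fun t ht => ?_
  rcases le_total ξ₀ (xi Φ) with hξ | hξ
  · exact (hT₁ x Φ hΦ hξ t ht).trans ((le_max_left _ _).trans (le_max_right _ _))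
  · exact (hT₂ x Φ hΦ.1 hξ t ht).trans ((le_max_right _ _).trans (le_max_right _ _))
end
end
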